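/- arXiv:2503.20087 — 4 statements merged into one kernel-verified Lean document; each statement's English description precedes it below -/
import Mathlib

section
/- Variance bound for the random feature estimate (Lemma 1, first inequality): under the setup below, for every x ∈ ℝ^d, E_θ[(⟨ŵ, Φ_θ(x)⟩ − f(x))²] ≤ 2 I / m, where I = ∫_Θ γ(θ)²/p(θ) dμ(θ). -/
open MeasureTheory

/-- The mean squared error of the empirical mean of `m` i.i.d. copies of a square-integrable
random variable is at most its second moment divided by `m`. -/
theorem integral_sq_empirical_mean_sub_le {Ω : Type*} [MeasurableSpace Ω] {m : ℕ} (hm : 0 < m)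
    (ν : Measure Ω) [IsProbabilityMeasure ν] {X : Ω → ℝ} (hX : MemLp X 2 ν) :
    ∫ ω : Fin m → Ω, ((∑ k, X (ω k) / m) - ∫ a, X a ∂ν) ^ 2 ∂(Measure.pi fun _ : Fin m => ν)
      ≤ (∫ a, X a ^ 2 ∂ν) / m := by
  have hm' : (m : ℝ) ≠ 0 := by positivity
  set Y : Ω → ℝ := fun a => (m : ℝ)⁻¹ * X a with hY_def
  have hY : MemLp Y 2 ν := hX.const_mul _
  have hYk (k : Fin m) : MemLp (fun ω : Fin m → Ω => Y (ω k)) 2 (Measure.pi fun _ => ν) :=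
    hY.comp_measurePreserving (measurePreserving_eval (fun _ : Fin m => ν) k)
  have hsum : (fun ω : Fin m → Ω => ∑ k, X (ω k) / m) = ∑ k, fun ω : Fin m → Ω => Y (ω k) := by
    ext ω
    simp [hY_def, div_eq_inv_mul]
  have hmean : ∫ ω : Fin m → Ω, (∑ k, fun ω : Fin m → Ω => Y (ω k)) ω
      ∂(Measure.pi fun _ : Fin m => ν) = ∫ a, X a ∂ν := by
    simp only [Finset.sum_apply]
    rw [integral_finsetSum _ fun k _ => (hYk k).integrable (by norm_num)]
    have hk (k : Fin m) : ∫ ω : Fin m → Ω, Y (ω k) ∂(Measure.pi fun _ : Fin m => ν)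
        = (m : ℝ)⁻¹ * ∫ a, X a ∂ν := by
      rw [integral_comp_eval (μ := fun _ : Fin m => ν) hY.aestronglyMeasurable,
        integral_const_mul]
    simp [hk, hm']
  have hvar := ProbabilityTheory.variance_sum_pi (μ := fun _ : Fin m => ν) (X := fun _ => Y)
    fun _ => hY
  rw [ProbabilityTheory.variance_eq_integral
    (memLp_finsetSum' Finset.univ fun k _ => hYk k).aemeasurable, hmean, ← hsum] at hvar
  rw [hvar, Finset.sum_const, Finset.card_univ, Fintype.card_fin, nsmul_eq_mul,
    ProbabilityTheory.variance_const_mul]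
  have hle := ProbabilityTheory.variance_le_expectation_sq hX.aestronglyMeasurable
  calc (m : ℝ) * ((m : ℝ)⁻¹ ^ 2 * ProbabilityTheory.variance X ν)
      = ProbabilityTheory.variance X ν / m := by field_simp
    _ ≤ _ := by gcongr; exact hle

/-- **Variance bound for the random feature estimate (Lemma 1, first inequality).**
Setup: `(Θ, μ)` a σ-finite measure space, `p` a probability density w.r.t. `μ`
(`∫ p dμ = 1`, `p > 0` a.e.), `φ : ℝ^d × Θ → ℝ` measurable with `|φ(x,θ)| ≤ √2`,
`γ` measurable with `I = ∫ γ²/p dμ < ∞`, `f(x) = ∫ γ(θ) φ(x,θ) dμ(θ)`.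
`θ₁, …, θ_m` are i.i.d. with law `p·μ` (modelled by the product measure of
`m` copies of `μ.withDensity (ENNReal.ofReal ∘ p)`), and `ŵ_k = γ(θ_k)/(m p(θ_k))`.
Claim: `E_θ[(⟨ŵ, Φ_θ(x)⟩ - f(x))²] ≤ 2 I / m`. -/
theorem random_feature_estimate_variance_bound
    {Θ : Type*} [MeasurableSpace Θ] (d m : ℕ) (hm : 0 < m)
    (μ : Measure Θ) [SigmaFinite μ]
    (p : Θ → ℝ) (hp_meas : Measurable p) (hp_nonneg : ∀ θ, 0 ≤ p θ)
    (hp_prob : ∫⁻ θ, ENNReal.ofReal (p θ) ∂μ = 1)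
    (hp_pos : ∀ᵐ θ ∂μ, 0 < p θ)
    (φ : (Fin d → ℝ) → Θ → ℝ)
    (hφ_meas : Measurable (fun q : (Fin d → ℝ) × Θ => φ q.1 q.2))
    (hφ_bdd : ∀ x θ, |φ x θ| ≤ Real.sqrt 2)
    (γ : Θ → ℝ) (hγ_meas : Measurable γ)
    (hI : Integrable (fun θ => γ θ ^ 2 / p θ) μ)
    (f : (Fin d → ℝ) → ℝ) (hf : ∀ x, f x = ∫ θ, γ θ * φ x θ ∂μ)
    (x : Fin d → ℝ) :
    ∫ θs : Fin m → Θ,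
        ((∑ k, γ (θs k) / (m * p (θs k)) * φ x (θs k)) - f x) ^ 2
        ∂(Measure.pi fun _ : Fin m => μ.withDensity fun θ => ENNReal.ofReal (p θ))
      ≤ 2 * (∫ θ, γ θ ^ 2 / p θ ∂μ) / m := by
  set ν := μ.withDensity fun θ => ENNReal.ofReal (p θ) with hν_def
  have hν : IsProbabilityMeasure ν := ⟨by simpa [hν_def] using hp_prob⟩
  have hφx : Measurable (φ x) := hφ_meas.comp measurable_prodMk_left
  have hdens : Measurable fun θ => ENNReal.ofReal (p θ) := hp_meas.ennreal_ofReal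
  have hfin : ∀ᵐ θ ∂μ, ENNReal.ofReal (p θ) < ⊤ := .of_forall fun _ => ENNReal.ofReal_lt_top
  set X : Θ → ℝ := fun θ => γ θ / p θ * φ x θ with hX_def
  have hX_meas : Measurable X := (hγ_meas.div hp_meas).mul hφx
  have hφ_sq (θ : Θ) : φ x θ ^ 2 ≤ 2 := by
    rw [← sq_abs, ← Real.sq_sqrt (zero_le_two (α := ℝ))]
    gcongr
    exact hφ_bdd x θ
  have hsq_eq : (fun θ => (ENNReal.ofReal (p θ)).toReal • X θ ^ 2)
      =ᵐ[μ] fun θ => γ θ ^ 2 / p θ * φ x θ ^ 2 := by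
    filter_upwards [hp_pos] with θ hθ
    rw [ENNReal.toReal_ofReal hθ.le, smul_eq_mul]
    simp only [hX_def]
    field_simp
  have hsq_int : Integrable (fun θ => γ θ ^ 2 / p θ * φ x θ ^ 2) μ :=
    hI.mul_bdd (c := 2) (hφx.pow_const 2).aestronglyMeasurable <| .of_forall fun θ => by
      simpa using hφ_sq θ
  have hX : MemLp X 2 ν := by
    rw [memLp_two_iff_integrable_sq hX_meas.aestronglyMeasurable,
      integrable_withDensity_iff_integrable_smul' hdens hfin]
    exact hsq_int.congr hsq_eq.symm
  have hmean : ∫ θ, X θ ∂ν = f x := by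
    rw [hf, integral_withDensity_eq_integral_toReal_smul hdens hfin]
    refine integral_congr_ae ?_
    filter_upwards [hp_pos] with θ hθ
    rw [ENNReal.toReal_ofReal hθ.le, smul_eq_mul]
    simp only [hX_def]
    field_simp
  have hsecond : ∫ θ, X θ ^ 2 ∂ν ≤ 2 * ∫ θ, γ θ ^ 2 / p θ ∂μ := by
    rw [integral_withDensity_eq_integral_toReal_smul hdens hfin, integral_congr_ae hsq_eq,
      ← integral_const_mul]
    refine integral_mono hsq_int (hI.const_mul 2) fun θ => ?_
    rw [mul_comm 2]
    exact mul_le_mul_of_nonneg_left (hφ_sq θ) (div_nonneg (sq_nonneg _) (hp_nonneg θ))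
  have hterm (θ : Θ) : γ θ / (m * p θ) * φ x θ = X θ / m := by
    simp only [hX_def, div_eq_mul_inv, mul_inv]
    ring
  simp only [hterm, ← hmean]
  refine (integral_sq_empirical_mean_sub_le hm ν hX).trans ?_
  gcongr
end

section
/- Multi-kernel approximation bound (Lemma 2): under the multi-kernel random feature setup below, for every x ∈ ℝ^d and every y ∈ ℝ, E_θ[(Σ_{j=1}^N ⟨ŵ_j, Φ_{θ_j}(x)⟩ − y)²] ≤ (2N/m) Σ_{j=1}^N I_j + (Σ_{j=1}^N f_j(x) − y)². -/
open MeasureTheory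

open ProbabilityTheory in
/-- Bias-variance decomposition around an arbitrary constant. -/
lemma integral_sub_const_sq_eq_variance_add {Ω : Type*} [MeasurableSpace Ω] {P : Measure Ω}
    [IsProbabilityMeasure P] {X : Ω → ℝ} (hX : MemLp X 2 P) (y : ℝ) :
    ∫ ω, (X ω - y) ^ 2 ∂P = Var[X; P] + ((∫ ω, X ω ∂P) - y) ^ 2 := by
  have h := variance_eq_sub (hX.sub (memLp_const (μ := P) y))
  have h' : Var[X - fun _ => y; P] = Var[X; P] :=
    variance_sub_const hX.aestronglyMeasurable y
  have hint : ∫ ω, (X - fun _ => y : Ω → ℝ) ω ∂P = (∫ ω, X ω ∂P) - y := by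
    simp [integral_sub (hX.integrable (by norm_num : (1 : ENNReal) ≤ 2)) (integrable_const y)]
  rw [h', hint] at h
  simp only [Pi.pow_apply, Pi.sub_apply] at h
  linarith

section PiSum

open ProbabilityTheory

variable {ι : Type*} [Fintype ι] {Ω : ι → Type*} [∀ i, MeasurableSpace (Ω i)]
  {P : ∀ i, Measure (Ω i)} [∀ i, IsProbabilityMeasure (P i)] {X : ∀ i, Ω i → ℝ}

lemma memLp_pi_sum (hX : ∀ i, MemLp (X i) 2 (P i)) :
    MemLp (fun ω : ∀ i, Ω i => ∑ i, X i (ω i)) 2 (Measure.pi P) :=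
  memLp_finsetSum _ fun i _ => (hX i).comp_measurePreserving (measurePreserving_eval P i)

lemma integral_pi_sum (hX : ∀ i, MemLp (X i) 2 (P i)) :
    ∫ ω : ∀ i, Ω i, ∑ i, X i (ω i) ∂(Measure.pi P) = ∑ i, ∫ ω, X i ω ∂(P i) := by
  rw [integral_finsetSum]
  · exact Finset.sum_congr rfl fun i _ => integral_comp_eval (hX i).aestronglyMeasurable
  · exact fun i _ => ((hX i).comp_measurePreserving (measurePreserving_eval P i)).integrable
      (by norm_num)

lemma variance_pi_sum (hX : ∀ i, MemLp (X i) 2 (P i)) :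
    Var[fun ω : ∀ i, Ω i => ∑ i, X i (ω i); Measure.pi P] = ∑ i, Var[X i; P i] := by
  rw [← variance_sum_pi hX]
  congr 1
  ext ω
  simp

end PiSum

section ImportanceSampling

open ProbabilityTheory

variable {T : Type*} [MeasurableSpace T] {μ : Measure T} {p γ φ : T → ℝ}

lemma integral_withDensity_ofReal (hp : Measurable p) (hp0 : ∀ θ, 0 ≤ p θ) (g : T → ℝ) :
    ∫ θ, g θ ∂(μ.withDensity fun θ => ENNReal.ofReal (p θ)) = ∫ θ, p θ * g θ ∂μ := by
  rw [integral_withDensity_eq_integral_toReal_smul hp.ennreal_ofReal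
    (ae_of_all _ fun _ => ENNReal.ofReal_lt_top)]
  simp [ENNReal.toReal_ofReal (hp0 _)]

lemma integrable_withDensity_ofReal_iff (hp : Measurable p) (hp0 : ∀ θ, 0 ≤ p θ) (g : T → ℝ) :
    Integrable g (μ.withDensity fun θ => ENNReal.ofReal (p θ)) ↔
      Integrable (fun θ => p θ * g θ) μ := by
  rw [integrable_withDensity_iff_integrable_smul' hp.ennreal_ofReal
    (ae_of_all _ fun _ => ENNReal.ofReal_lt_top)]
  simp [ENNReal.toReal_ofReal (hp0 _)]

lemma integral_importance_weight (hp : Measurable p) (hp0 : ∀ θ, 0 ≤ p θ)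
    (hpos : ∀ᵐ θ ∂μ, 0 < p θ) (c : ℝ) :
    ∫ θ, γ θ / (c * p θ) * φ θ ∂(μ.withDensity fun θ => ENNReal.ofReal (p θ)) =
      c⁻¹ * ∫ θ, γ θ * φ θ ∂μ := by
  rw [integral_withDensity_ofReal hp hp0, ← integral_const_mul]
  refine integral_congr_ae ?_
  filter_upwards [hpos] with θ hθ
  rw [div_eq_mul_inv, mul_inv]
  field_simp

lemma mul_importance_weight_sq_le {a b p C c : ℝ} (hp : 0 ≤ p) (hb : b ^ 2 ≤ C) :
    p * (a / (c * p) * b) ^ 2 ≤ C / c ^ 2 * (a ^ 2 / p) := by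
  rcases hp.eq_or_lt with rfl | hp
  · simp
  · have : p * (a / (c * p) * b) ^ 2 = (c ^ 2)⁻¹ * (a ^ 2 / p) * b ^ 2 := by
      rw [div_eq_mul_inv, mul_inv]
      field_simp
    rw [this]
    calc (c ^ 2)⁻¹ * (a ^ 2 / p) * b ^ 2 ≤ (c ^ 2)⁻¹ * (a ^ 2 / p) * C := by gcongr
      _ = _ := by ring

lemma memLp_importance_weight (hp : Measurable p) (hp0 : ∀ θ, 0 ≤ p θ)
    (hγ : Measurable γ) (hφ : Measurable φ) {C : ℝ} (hC : ∀ θ, φ θ ^ 2 ≤ C)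
    (hI : Integrable (fun θ => γ θ ^ 2 / p θ) μ) (c : ℝ) :
    MemLp (fun θ => γ θ / (c * p θ) * φ θ) 2
      (μ.withDensity fun θ => ENNReal.ofReal (p θ)) := by
  rw [memLp_two_iff_integrable_sq (by fun_prop), integrable_withDensity_ofReal_iff hp hp0]
  refine (hI.const_mul (C / c ^ 2)).mono' (by fun_prop) (ae_of_all _ fun θ => ?_)
  rw [Real.norm_of_nonneg (mul_nonneg (hp0 θ) (sq_nonneg _))]
  exact mul_importance_weight_sq_le (hp0 θ) (hC θ)

lemma variance_importance_weight_le (hp : Measurable p) (hp0 : ∀ θ, 0 ≤ p θ)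
    [IsProbabilityMeasure (μ.withDensity fun θ => ENNReal.ofReal (p θ))]
    (hγ : Measurable γ) (hφ : Measurable φ) {C : ℝ} (hC : ∀ θ, φ θ ^ 2 ≤ C)
    (hI : Integrable (fun θ => γ θ ^ 2 / p θ) μ) (c : ℝ) :
    Var[fun θ => γ θ / (c * p θ) * φ θ; μ.withDensity fun θ => ENNReal.ofReal (p θ)] ≤
      C / c ^ 2 * ∫ θ, γ θ ^ 2 / p θ ∂μ := by
  refine (variance_le_expectation_sq (by fun_prop)).trans ?_
  simp only [Pi.pow_apply]
  rw [integral_withDensity_ofReal hp hp0, ← integral_const_mul]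
  exact integral_mono_of_nonneg
    (ae_of_all _ fun θ => mul_nonneg (hp0 θ) (sq_nonneg _)) (hI.const_mul _)
    (ae_of_all _ fun θ => mul_importance_weight_sq_le (hp0 θ) (hC θ))

end ImportanceSampling

/-- **Multi-kernel approximation bound (Lemma 2).**
For `j = 1,…,N`: `(Θⱼ, μⱼ)` σ-finite measure spaces, `pⱼ` probability densities
(`∫ pⱼ dμⱼ = 1`, `pⱼ > 0` a.e.), `φⱼ : ℝ^d × Θⱼ → ℝ` measurable with `|φⱼ| ≤ √2`,
`γⱼ` measurable with `Iⱼ = ∫ γⱼ²/pⱼ dμⱼ < ∞`, `fⱼ(x) = ∫ γⱼ(θ) φⱼ(x,θ) dμⱼ(θ)`.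
The independent family `(θⱼₖ)` with `θⱼₖ ~ pⱼ·μⱼ` is modelled by the product
measure `⊗ⱼ ⊗ₖ (μⱼ).withDensity (ofReal ∘ pⱼ)` on `Π j, Fin m → Θ j`, and
`(ŵⱼ)ₖ = γⱼ(θⱼₖ)/(m pⱼ(θⱼₖ))`.
Claim: for all `x ∈ ℝ^d`, `y ∈ ℝ`,
`E_θ[(∑ⱼ ⟨ŵⱼ, Φ_{θⱼ}(x)⟩ − y)²] ≤ (2N/m) ∑ⱼ Iⱼ + (∑ⱼ fⱼ(x) − y)²`. -/
theorem multi_kernel_approximation_bound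
    (d N m : ℕ) (hm : 0 < m)
    (Θ : Fin N → Type*) [∀ j, MeasurableSpace (Θ j)]
    (μ : ∀ j, Measure (Θ j)) [∀ j, SigmaFinite (μ j)]
    (p : ∀ j, Θ j → ℝ) (hp_meas : ∀ j, Measurable (p j))
    (hp_nonneg : ∀ j θ, 0 ≤ p j θ)
    (hp_prob : ∀ j, ∫⁻ θ, ENNReal.ofReal (p j θ) ∂(μ j) = 1)
    (hp_pos : ∀ j, ∀ᵐ θ ∂(μ j), 0 < p j θ)
    (φ : ∀ j, (Fin d → ℝ) → Θ j → ℝ)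
    (hφ_meas : ∀ j, Measurable (fun q : (Fin d → ℝ) × Θ j => φ j q.1 q.2))
    (hφ_bdd : ∀ j x θ, |φ j x θ| ≤ Real.sqrt 2)
    (γ : ∀ j, Θ j → ℝ) (hγ_meas : ∀ j, Measurable (γ j))
    (hI : ∀ j, Integrable (fun θ => γ j θ ^ 2 / p j θ) (μ j))
    (f : ∀ j, (Fin d → ℝ) → ℝ)
    (hf : ∀ j x, f j x = ∫ θ, γ j θ * φ j x θ ∂(μ j))
    (x : Fin d → ℝ) (y : ℝ) :
    ∫ ω : ∀ j, Fin m → Θ j,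
        ((∑ j, ∑ k, γ j (ω j k) / (m * p j (ω j k)) * φ j x (ω j k)) - y) ^ 2
        ∂(Measure.pi fun j =>
            Measure.pi fun _ : Fin m => (μ j).withDensity fun θ => ENNReal.ofReal (p j θ))
      ≤ (2 * N / m) * (∑ j, ∫ θ, γ j θ ^ 2 / p j θ ∂(μ j)) + ((∑ j, f j x) - y) ^ 2 := by
  have hprob : ∀ j, IsProbabilityMeasure ((μ j).withDensity fun θ => ENNReal.ofReal (p j θ)) :=
    fun j => ⟨by rw [withDensity_apply _ MeasurableSet.univ, setLIntegral_univ, hp_prob j]⟩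
  have hφx : ∀ j, Measurable (φ j x) := fun j => (hφ_meas j).comp measurable_prodMk_left
  have hφsq : ∀ j θ, φ j x θ ^ 2 ≤ 2 := fun j θ => by
    rw [← sq_abs, ← Real.sq_sqrt (zero_le_two (α := ℝ))]
    gcongr
    exact hφ_bdd j x θ
  have hm' : (m : ℝ) ≠ 0 := by positivity
  have hZ := fun j => memLp_importance_weight (hp_meas j) (hp_nonneg j) (hγ_meas j) (hφx j)
    (hφsq j) (hI j) m
  have hS := fun j => memLp_pi_sum fun _ : Fin m => hZ j
  have hmean : ∀ j, ∑ _k : Fin m, ∫ θ, γ j θ / (m * p j θ) * φ j x θ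
      ∂((μ j).withDensity fun θ => ENNReal.ofReal (p j θ)) = f j x := fun j => by
    rw [integral_importance_weight (hp_meas j) (hp_nonneg j) (hp_pos j), hf]
    simp [hm']
  rw [integral_sub_const_sq_eq_variance_add (memLp_pi_sum hS), variance_pi_sum hS,
    integral_pi_sum hS]
  simp_rw [fun j => variance_pi_sum fun _ : Fin m => hZ j,
    fun j => integral_pi_sum fun _ : Fin m => hZ j, hmean]
  gcongr
  rw [Finset.mul_sum]
  refine Finset.sum_le_sum fun j _ => ?_
  have hN : (1 : ℝ) ≤ N := by exact_mod_cast j.pos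
  have hI0 : 0 ≤ ∫ θ, γ j θ ^ 2 / p j θ ∂(μ j) :=
    integral_nonneg fun θ => div_nonneg (sq_nonneg _) (hp_nonneg j θ)
  calc _ ≤ ∑ _k : Fin m, 2 / (m : ℝ) ^ 2 * ∫ θ, γ j θ ^ 2 / p j θ ∂(μ j) :=
        Finset.sum_le_sum fun _ _ => variance_importance_weight_le (hp_meas j) (hp_nonneg j)
          (hγ_meas j) (hφx j) (hφsq j) (hI j) m
    _ = 2 * 1 / m * ∫ θ, γ j θ ^ 2 / p j θ ∂(μ j) := by
        simp
        field_simp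
    _ ≤ _ := by gcongr
end

section
/- Theorem 2, asymptotic form (relation (3.16)): under the setup below, there exists a constant C > 0 depending only on N and Y such that for every T ≥ 1, taking λ = 1 and m = ⌈√T⌉, for every R > 0, every j ∈ {1,…,N}, and every coefficient function γ_j with I_j ≤ R², (1/2) E_θ[Σ_{t=1}^T (⟨α_t, z_t⟩ − y_t)²] ≤ (1/2) Σ_{t=1}^T (f_j(x_t) − y_t)² + C (1 + R²)(1 + ln(T+1)) √T. -/
open MeasureTheory

/-- The Vovk–Azoury–Warmuth (VAW) iterates with regularization parameter `lam`,
applied to input vectors `u 1, u 2, …` (indexed by a finite type `ι`) and labels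
`y 1, y 2, …`:  `w t = S t ⁻¹ (∑_{i=1}^{t-1} y i • u i)`, where
`S t = lam • I + ∑_{i=1}^{t} (u i) (u i)ᵀ`. -/
noncomputable def vaw {ι : Type*} [Fintype ι] [DecidableEq ι] (lam : ℝ)
    (u : ℕ → ι → ℝ) (y : ℕ → ℝ) (t : ℕ) : ι → ℝ :=
  ((lam • (1 : Matrix ι ι ℝ) + ∑ i ∈ Finset.Icc 1 t, Matrix.vecMulVec (u i) (u i))⁻¹).mulVec
    (∑ i ∈ Finset.Icc 1 (t - 1), y i • u i)

section VAWRegret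

open Matrix

variable {ι : Type*} [Fintype ι] [DecidableEq ι]

/-- Completing the square for the quadratic form of a positive definite matrix. -/
lemma Matrix.PosDef.two_mul_dotProduct_sub_le {S : Matrix ι ι ℝ} (hS : S.PosDef) (b x : ι → ℝ) :
    2 * (b ⬝ᵥ x) - x ⬝ᵥ S *ᵥ x ≤ b ⬝ᵥ S⁻¹ *ᵥ b := by
  have h := hS.posSemidef.dotProduct_mulVec_nonneg (S⁻¹ *ᵥ b - x)
  have hSb : S *ᵥ (S⁻¹ *ᵥ b) = b := by
    rw [mulVec_mulVec, mul_nonsing_inv _ (S.isUnit_iff_isUnit_det.mp hS.isUnit), one_mulVec]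
  have hsymm : (S⁻¹ *ᵥ b) ⬝ᵥ S *ᵥ x = b ⬝ᵥ x := by
    have hT : Sᵀ = S := by simpa using hS.isHermitian.eq
    rw [dotProduct_mulVec, ← mulVec_transpose, hT, hSb]
  rw [star_trivial, mulVec_sub, hSb, sub_dotProduct, dotProduct_sub, dotProduct_sub, hsymm,
    dotProduct_comm (S⁻¹ *ᵥ b) b, dotProduct_comm x b] at h
  linarith

/-- One step of the VAW potential argument. -/
lemma Matrix.PosDef.sq_dotProduct_sub_le {S : Matrix ι ι ℝ} (hS : S.PosDef) (b u : ι → ℝ) (y : ℝ)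
    (hS' : (S + vecMulVec u u).PosDef) :
    (((S + vecMulVec u u)⁻¹ *ᵥ b) ⬝ᵥ u - y) ^ 2 ≤
      y ^ 2 + b ⬝ᵥ S⁻¹ *ᵥ b - (b + y • u) ⬝ᵥ (S + vecMulVec u u)⁻¹ *ᵥ (b + y • u)
        + y ^ 2 * (u ⬝ᵥ (S + vecMulVec u u)⁻¹ *ᵥ u) := by
  set A := S + vecMulVec u u with hA
  have hAb : A *ᵥ (A⁻¹ *ᵥ b) = b := by
    rw [mulVec_mulVec, mul_nonsing_inv _ (A.isUnit_iff_isUnit_det.mp hS'.isUnit), one_mulVec]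
  have hsymm : b ⬝ᵥ A⁻¹ *ᵥ u = u ⬝ᵥ A⁻¹ *ᵥ b := by
    have hT : A⁻¹ᵀ = A⁻¹ := by simpa using hS'.inv.isHermitian.eq
    rw [dotProduct_mulVec, ← mulVec_transpose, hT, dotProduct_comm]
  have hx := hS.two_mul_dotProduct_sub_le b (A⁻¹ *ᵥ b)
  have hquad : (A⁻¹ *ᵥ b) ⬝ᵥ S *ᵥ (A⁻¹ *ᵥ b) = b ⬝ᵥ A⁻¹ *ᵥ b - (u ⬝ᵥ A⁻¹ *ᵥ b) ^ 2 := by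
    have h : S *ᵥ (A⁻¹ *ᵥ b) = b - (u ⬝ᵥ A⁻¹ *ᵥ b) • u := by
      rw [eq_sub_iff_add_eq]
      conv_rhs => rw [← hAb]
      rw [hA, add_mulVec, vecMulVec_mulVec, ← hA]
      simp
    rw [h, dotProduct_sub, dotProduct_smul, dotProduct_comm _ b, dotProduct_comm _ u, smul_eq_mul]
    ring
  rw [dotProduct_comm _ u]
  simp only [mulVec_add, mulVec_smul, dotProduct_add, add_dotProduct, smul_dotProduct,
    dotProduct_smul, smul_eq_mul, hsymm]
  nlinarith

/-- The logarithm of the determinant grows by at least the leverage of a rank-one update. -/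
lemma Matrix.PosDef.dotProduct_inv_mulVec_le_log_det {S : Matrix ι ι ℝ} (hS : S.PosDef)
    (u : ι → ℝ) (hS' : (S + vecMulVec u u).PosDef) :
    u ⬝ᵥ (S + vecMulVec u u)⁻¹ *ᵥ u ≤
      Real.log (S + vecMulVec u u).det - Real.log S.det := by
  set A := S + vecMulVec u u with hA
  have hdet : S.det = A.det * (1 - u ⬝ᵥ A⁻¹ *ᵥ u) := by
    have hSA : S = A + replicateCol Unit (-u) * replicateRow Unit u := by
      rw [← vecMulVec_eq, neg_vecMulVec, hA]
      abel
    have h := det_add_replicateCol_mul_replicateRow (ι := Unit)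
      (A.isUnit_iff_isUnit_det.mp hS'.isUnit) (-u) u
    rw [← hSA] at h
    rw [h, det_unique (1 + replicateRow Unit u * A⁻¹ * replicateCol Unit (-u)), add_apply, one_apply_eq, Matrix.mul_assoc, ← replicateCol_mulVec,
      replicateRow_mul_replicateCol_apply, mulVec_neg, dotProduct_neg, sub_eq_add_neg]
  have hpos : 0 < 1 - u ⬝ᵥ A⁻¹ *ᵥ u :=
    pos_of_mul_pos_right (hdet ▸ hS.det_pos) hS'.det_pos.le
  rw [hdet, Real.log_mul hS'.det_pos.ne' hpos.ne']
  linarith [Real.log_le_sub_one_of_pos hpos]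

lemma Matrix.PosSemidef.det_le_trace_pow {S : Matrix ι ι ℝ} (hS : S.PosSemidef) :
    S.det ≤ S.trace ^ Fintype.card ι := by
  rw [hS.1.det_eq_prod_eigenvalues, hS.1.trace_eq_sum_eigenvalues]
  simp only [RCLike.ofReal_real_eq_id, id_eq]
  calc ∏ i, hS.1.eigenvalues i ≤ ∏ _i : ι, ∑ j, hS.1.eigenvalues j :=
        Finset.prod_le_prod (fun i _ => hS.eigenvalues_nonneg i) fun i _ =>
          Finset.single_le_sum (fun j _ => hS.eigenvalues_nonneg j) (Finset.mem_univ i)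
    _ = _ := by simp

lemma posDef_one_add_sum_vecMulVec (u : ℕ → ι → ℝ) (t : ℕ) :
    (((1 : ℝ) • (1 : Matrix ι ι ℝ)) + ∑ i ∈ Finset.Icc 1 t, vecMulVec (u i) (u i)).PosDef := by
  rw [one_smul]
  refine PosDef.one.add_posSemidef (posSemidef_sum _ fun i _ => ?_)
  simpa using posSemidef_vecMulVec_self_star (u i)

/-- The VAW regret bound in terms of the determinant of the regularized Gram matrix. -/
lemma vaw_sum_sq_le_log_det (u : ℕ → ι → ℝ) (y : ℕ → ℝ) (Y : ℝ) (T : ℕ)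
    (hy : ∀ t ∈ Finset.Icc 1 T, |y t| ≤ Y) :
    ∑ t ∈ Finset.Icc 1 T, (vaw 1 u y t ⬝ᵥ u t - y t) ^ 2 ≤
      ∑ t ∈ Finset.Icc 1 T, y t ^ 2
        - (∑ i ∈ Finset.Icc 1 T, y i • u i) ⬝ᵥ
          ((1 : ℝ) • (1 : Matrix ι ι ℝ) + ∑ i ∈ Finset.Icc 1 T, vecMulVec (u i) (u i))⁻¹ *ᵥ
            (∑ i ∈ Finset.Icc 1 T, y i • u i)
        + Y ^ 2 * Real.log
          ((1 : ℝ) • (1 : Matrix ι ι ℝ) + ∑ i ∈ Finset.Icc 1 T, vecMulVec (u i) (u i)).det := by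
  induction T with
  | zero => simp
  | succ T ih =>
    have ih := ih fun t ht => hy t (Finset.Icc_subset_Icc_right T.le_succ ht)
    have hS := posDef_one_add_sum_vecMulVec u T
    have hS' := posDef_one_add_sum_vecMulVec u (T + 1)
    have hvaw : vaw 1 u y (T + 1) = ((1 : ℝ) • (1 : Matrix ι ι ℝ) +
        ∑ i ∈ Finset.Icc 1 (T + 1), vecMulVec (u i) (u i))⁻¹ *ᵥ
          (∑ i ∈ Finset.Icc 1 T, y i • u i) := rfl
    rw [Finset.sum_Icc_succ_top (by lia), Finset.sum_Icc_succ_top (by lia),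
      Finset.sum_Icc_succ_top (f := fun i => y i • u i) (by lia), hvaw]
    rw [Finset.sum_Icc_succ_top (by lia), ← add_assoc] at hS' ⊢
    have hstep := hS.sq_dotProduct_sub_le (∑ i ∈ Finset.Icc 1 T, y i • u i) (u (T + 1))
      (y (T + 1)) hS'
    have hlog := hS.dotProduct_inv_mulVec_le_log_det (u (T + 1)) hS'
    have hnonneg := hS'.inv.posSemidef.dotProduct_mulVec_nonneg (u (T + 1))
    have hsq : y (T + 1) ^ 2 ≤ Y ^ 2 := sq_le_sq.mpr
      ((hy (T + 1) (by simp)).trans (le_abs_self Y))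
    rw [star_trivial] at hnonneg
    have := (mul_le_mul_of_nonneg_right hsq hnonneg).trans
      (mul_le_mul_of_nonneg_left hlog (sq_nonneg Y))
    linarith

/-- The VAW regret bound against an arbitrary linear predictor `w`. -/
lemma vaw_regret_le (u : ℕ → ι → ℝ) (y : ℕ → ℝ) (Y : ℝ) (T : ℕ)
    (hy : ∀ t ∈ Finset.Icc 1 T, |y t| ≤ Y) (w : ι → ℝ) :
    ∑ t ∈ Finset.Icc 1 T, (vaw 1 u y t ⬝ᵥ u t - y t) ^ 2 ≤
      ∑ t ∈ Finset.Icc 1 T, (w ⬝ᵥ u t - y t) ^ 2 + w ⬝ᵥ w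
        + Y ^ 2 * (Fintype.card ι *
          Real.log (Fintype.card ι + ∑ t ∈ Finset.Icc 1 T, u t ⬝ᵥ u t)) := by
  have hS := posDef_one_add_sum_vecMulVec u T
  have hreg := vaw_sum_sq_le_log_det u y Y T hy
  set S := (1 : ℝ) • (1 : Matrix ι ι ℝ) + ∑ i ∈ Finset.Icc 1 T, vecMulVec (u i) (u i) with hSdef
  have hmin := hS.two_mul_dotProduct_sub_le (∑ i ∈ Finset.Icc 1 T, y i • u i) w
  have hexp : ∑ t ∈ Finset.Icc 1 T, (w ⬝ᵥ u t - y t) ^ 2 + w ⬝ᵥ w =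
      ∑ t ∈ Finset.Icc 1 T, y t ^ 2 - 2 * ((∑ i ∈ Finset.Icc 1 T, y i • u i) ⬝ᵥ w)
        + w ⬝ᵥ S *ᵥ w := by
    rw [hSdef, add_mulVec, one_smul, one_mulVec, sum_mulVec, dotProduct_add, dotProduct_sum,
      sum_dotProduct, Finset.mul_sum, ← Finset.sum_sub_distrib, ← add_assoc,
      add_right_comm, ← Finset.sum_add_distrib]
    congr 1
    refine Finset.sum_congr rfl fun t _ => ?_
    simp only [smul_dotProduct, vecMulVec_mulVec, dotProduct_smul, smul_eq_mul,
      dotProduct_comm (u t) w, MulOpposite.smul_eq_mul_unop, MulOpposite.unop_op]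
    ring
  have htr : S.trace = Fintype.card ι + ∑ t ∈ Finset.Icc 1 T, u t ⬝ᵥ u t := by
    simp [hSdef, trace_sum, trace_vecMulVec]
  have hlog : Real.log S.det ≤ Fintype.card ι *
      Real.log (Fintype.card ι + ∑ t ∈ Finset.Icc 1 T, u t ⬝ᵥ u t) := by
    rw [← htr, ← Real.log_pow]
    exact Real.log_le_log hS.det_pos hS.posSemidef.det_le_trace_pow
  have := mul_le_mul_of_nonneg_left hlog (sq_nonneg Y)
  linarith

end VAWRegret

section TwoLevel

open Matrix

/-- The logarithmic term of the VAW regret with at most `2 √T` bounded features. -/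
lemma card_mul_log_le_of_sq_le_two {T m : ℕ} (hT : 1 ≤ T) (hm : (m : ℝ) ≤ 2 * √T)
    (U : ℕ → Fin m → ℝ) (hU : ∀ t k, U t k ^ 2 ≤ 2) :
    m * Real.log (m + ∑ t ∈ Finset.Icc 1 T, U t ⬝ᵥ U t) ≤
      4 * (√T * (1 + Real.log (T + 1))) := by
  have hT' : (1 : ℝ) ≤ T := by exact_mod_cast hT
  have hsqrt : √(T : ℝ) ≤ T := Real.sqrt_le_iff.mpr ⟨by linarith, by nlinarith⟩
  have hL : 0 ≤ Real.log ((T : ℝ) + 1) := Real.log_nonneg (by linarith)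
  rcases Nat.eq_zero_or_pos m with rfl | hm0
  · simp only [Nat.cast_zero, zero_mul]
    positivity
  have hm0' : (0 : ℝ) < m := by exact_mod_cast hm0
  have hdot : ∀ t, 0 ≤ U t ⬝ᵥ U t ∧ U t ⬝ᵥ U t ≤ 2 * m := fun t => by
    refine ⟨Finset.sum_nonneg fun k _ => mul_self_nonneg _, ?_⟩
    calc U t ⬝ᵥ U t ≤ ∑ _k : Fin m, (2 : ℝ) :=
          Finset.sum_le_sum fun k _ => by simpa [sq] using hU t k
      _ = 2 * m := by simp [mul_comm]
  have hsum : ∑ t ∈ Finset.Icc 1 T, U t ⬝ᵥ U t ≤ T * (2 * m) := by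
    simpa using Finset.sum_le_card_nsmul (Finset.Icc 1 T) _ _ fun t _ => (hdot t).2
  have hlog : Real.log (m + ∑ t ∈ Finset.Icc 1 T, U t ⬝ᵥ U t) ≤
      2 * (1 + Real.log (T + 1)) := by
    have h2 : Real.log 2 ≤ 1 := by linarith [Real.log_two_lt_d9]
    calc Real.log (m + ∑ t ∈ Finset.Icc 1 T, U t ⬝ᵥ U t)
        ≤ Real.log ((2 * ((T : ℝ) + 1)) ^ 2) := by
          refine Real.log_le_log
            (add_pos_of_pos_of_nonneg hm0' (Finset.sum_nonneg fun t _ => (hdot t).1)) ?_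
          nlinarith
      _ = 2 * (Real.log 2 + Real.log (T + 1)) := by
          rw [Real.log_pow, Real.log_mul two_ne_zero (by positivity)]
          norm_num
      _ ≤ _ := by linarith
  calc m * Real.log (m + ∑ t ∈ Finset.Icc 1 T, U t ⬝ᵥ U t)
      ≤ m * (2 * (1 + Real.log (T + 1))) := mul_le_mul_of_nonneg_left hlog hm0'.le
    _ ≤ 2 * √T * (2 * (1 + Real.log (T + 1))) := mul_le_mul_of_nonneg_right hm (by positivity)
    _ = _ := by ring

/-- The two-level VAW procedure competes, for each fixed realization of the features, with every
linear predictor over the features of a single expert. -/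
lemma vaw_two_level_regret_le {N T m : ℕ} {Y : ℝ} (hT : 1 ≤ T) (hm : (m : ℝ) ≤ 2 * √T)
    (U : Fin N → ℕ → Fin m → ℝ) (hU : ∀ j t k, U j t k ^ 2 ≤ 2) (y : ℕ → ℝ)
    (hy : ∀ t ∈ Finset.Icc 1 T, |y t| ≤ Y) (z : ℕ → Fin N → ℝ)
    (hz : ∀ t j, z t j = vaw 1 (U j) y t ⬝ᵥ U j t) (j : Fin N) (w : Fin m → ℝ) :
    ∑ t ∈ Finset.Icc 1 T, (vaw 1 z y t ⬝ᵥ z t - y t) ^ 2 ≤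
      ∑ t ∈ Finset.Icc 1 T, (w ⬝ᵥ U j t - y t) ^ 2 + w ⬝ᵥ w
        + (1 + 4 * Y ^ 2 + Y ^ 2 * (N * (N * (1 + 12 * Y ^ 2) + 2)))
          * (√T * (1 + Real.log (T + 1))) := by
  have hT' : (1 : ℝ) ≤ T := by exact_mod_cast hT
  have hsqrt : √(T : ℝ) ≤ T := Real.sqrt_le_iff.mpr ⟨by linarith, by nlinarith⟩
  have hsqrt1 : 1 ≤ √(T : ℝ) := Real.one_le_sqrt.mpr hT'
  have hL : 0 ≤ Real.log ((T : ℝ) + 1) := Real.log_nonneg (by linarith)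
  have hLT : Real.log ((T : ℝ) + 1) ≤ T := by
    linarith [Real.log_le_sub_one_of_pos (x := (T : ℝ) + 1) (by positivity)]
  have hN : (1 : ℝ) ≤ N := by exact_mod_cast j.pos
  have hexpert : ∀ i (v : Fin m → ℝ), ∑ t ∈ Finset.Icc 1 T, (z t i - y t) ^ 2 ≤
      ∑ t ∈ Finset.Icc 1 T, (v ⬝ᵥ U i t - y t) ^ 2 + v ⬝ᵥ v
        + Y ^ 2 * (4 * (√T * (1 + Real.log (T + 1)))) := fun i v => by
    have h := vaw_regret_le (U i) y Y T hy v
    simp only [← hz, Fintype.card_fin] at h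
    exact h.trans (add_le_add_right (mul_le_mul_of_nonneg_left
      (card_mul_log_le_of_sq_le_two hT hm (U i) (hU i)) (sq_nonneg Y)) _)
  have hprod : √T * (1 + Real.log (T + 1)) ≤ T * (1 + T) := by gcongr
  have hysum : ∑ t ∈ Finset.Icc 1 T, y t ^ 2 ≤ T * Y ^ 2 := by
    simpa using Finset.sum_le_card_nsmul (Finset.Icc 1 T) (fun t => y t ^ 2) (Y ^ 2) fun t ht =>
      sq_le_sq.mpr ((hy t ht).trans (le_abs_self Y))
  have hzi : ∀ i, ∑ t ∈ Finset.Icc 1 T, z t i ^ 2 ≤ 12 * Y ^ 2 * ((T : ℝ) + 1) ^ 2 := fun i => by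
    have h0 := hexpert i 0
    simp only [zero_dotProduct, zero_sub, neg_sq, add_zero] at h0
    have h1 : ∑ t ∈ Finset.Icc 1 T, z t i ^ 2 ≤
        2 * ∑ t ∈ Finset.Icc 1 T, (z t i - y t) ^ 2 + 2 * ∑ t ∈ Finset.Icc 1 T, y t ^ 2 := by
      rw [Finset.mul_sum, Finset.mul_sum, ← Finset.sum_add_distrib]
      exact Finset.sum_le_sum fun t _ => by nlinarith [sq_nonneg (z t i - 2 * y t)]
    have h2 := mul_le_mul_of_nonneg_left hprod (sq_nonneg Y)
    nlinarith [mul_nonneg (sq_nonneg Y) (zero_le_one.trans hT'), sq_nonneg Y]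
  have hzsum : ∑ t ∈ Finset.Icc 1 T, z t ⬝ᵥ z t ≤ N * (12 * Y ^ 2 * ((T : ℝ) + 1) ^ 2) := by
    simp only [dotProduct, ← sq]
    rw [Finset.sum_comm]
    simpa using Finset.sum_le_card_nsmul Finset.univ _ _ fun i _ => hzi i
  have hz0 : 0 ≤ ∑ t ∈ Finset.Icc 1 T, z t ⬝ᵥ z t :=
    Finset.sum_nonneg fun t _ => Finset.sum_nonneg fun i _ => mul_self_nonneg _
  have hlog : Real.log (N + ∑ t ∈ Finset.Icc 1 T, z t ⬝ᵥ z t) ≤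
      (N * (1 + 12 * Y ^ 2) + 2) * (√T * (1 + Real.log (T + 1))) := by
    set K : ℝ := N * (1 + 12 * Y ^ 2) with hK
    have hKpos : 0 < K := by positivity
    have hKlog : Real.log K ≤ K := by linarith [Real.log_le_sub_one_of_pos hKpos]
    calc Real.log (N + ∑ t ∈ Finset.Icc 1 T, z t ⬝ᵥ z t)
        ≤ Real.log (K * ((T : ℝ) + 1) ^ 2) := by
          refine Real.log_le_log (by positivity) ?_
          have : (N : ℝ) * 1 ≤ N * ((T : ℝ) + 1) ^ 2 := by gcongr; nlinarith
          rw [hK]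
          linarith
      _ = Real.log K + 2 * Real.log (T + 1) := by
          rw [Real.log_mul hKpos.ne' (by positivity), Real.log_pow]
          norm_num
      _ ≤ (K + 2) * (1 * (1 + Real.log (T + 1))) := by nlinarith
      _ ≤ _ := by gcongr
  have hmeta := vaw_regret_le z y Y T hy (Pi.single j 1)
  simp only [single_dotProduct, one_mul, Pi.single_eq_same, Fintype.card_fin] at hmeta
  have h1 : (1 : ℝ) ≤ √T * (1 + Real.log (T + 1)) := by nlinarith
  have h2 : Y ^ 2 * (N * Real.log (N + ∑ t ∈ Finset.Icc 1 T, z t ⬝ᵥ z t)) ≤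
      Y ^ 2 * (N * ((N * (1 + 12 * Y ^ 2) + 2) * (√T * (1 + Real.log (T + 1))))) := by gcongr
  linarith [hexpert j w]

end TwoLevel

section RandomFeatures

open ProbabilityTheory

/-- Bias–variance bound for the mean square error of an empirical average. -/
lemma integral_sq_sum_div_sub_le {Ω : Type*} [MeasurableSpace Ω] (ν : Measure Ω)
    [IsProbabilityMeasure ν] {m : ℕ} (hm : 0 < m) {g : Ω → ℝ} (hg : MemLp g 2 ν) (c : ℝ) :
    Integrable (fun η : Fin m → Ω => (∑ k, g (η k) / m - c) ^ 2) (Measure.pi fun _ => ν) ∧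
    ∫ η : Fin m → Ω, (∑ k, g (η k) / m - c) ^ 2 ∂(Measure.pi fun _ => ν) ≤
      (∫ θ, g θ ∂ν - c) ^ 2 + (∫ θ, g θ ^ 2 ∂ν) / m := by
  have hm' : (m : ℝ) ≠ 0 := by exact_mod_cast hm.ne'
  have hgm : MemLp (fun θ => g θ / m) 2 ν := by
    simpa only [div_eq_mul_inv] using hg.mul_const (m : ℝ)⁻¹
  have hk : ∀ k : Fin m, MemLp (fun η : Fin m → Ω => g (η k) / m) 2 (Measure.pi fun _ => ν) :=
    fun k => hgm.comp_measurePreserving (measurePreserving_eval _ k)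
  have hX : MemLp (fun η : Fin m → Ω => ∑ k, g (η k) / m) 2 (Measure.pi fun _ => ν) :=
    memLp_finsetSum _ fun k _ => hk k
  have hXc : MemLp (fun η : Fin m → Ω => ∑ k, g (η k) / m - c) 2 (Measure.pi fun _ => ν) :=
    hX.sub (memLp_const c)
  refine ⟨hXc.integrable_sq, ?_⟩
  have hmean : ∫ η : Fin m → Ω, (∑ k, g (η k) / m - c) ∂(Measure.pi fun _ => ν) =
      ∫ θ, g θ ∂ν - c := by
    rw [integral_sub (hX.integrable one_le_two) (integrable_const c),
      integral_finsetSum _ fun k _ => (hk k).integrable one_le_two]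
    have (k : Fin m) : ∫ η : Fin m → Ω, g (η k) / m ∂(Measure.pi fun _ => ν) =
        (∫ θ, g θ ∂ν) / m := by
      rw [integral_comp_eval (μ := fun _ : Fin m => ν) (f := fun θ => g θ / m)
        hgm.aestronglyMeasurable, integral_div]
    simp [this, mul_div_cancel₀ _ hm']
  have hvar : Var[fun η : Fin m → Ω => ∑ k, g (η k) / m - c; Measure.pi fun _ => ν] ≤
      (∫ θ, g θ ^ 2 ∂ν) / m := by
    rw [variance_sub_const hX.aestronglyMeasurable]
    have h := variance_sum_pi (μ := fun _ : Fin m => ν) (X := fun _ θ => g θ / m) fun _ => hgm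
    rw [Finset.sum_fn] at h
    rw [h]
    have hle : Var[fun θ => g θ / m; ν] ≤ (∫ θ, g θ ^ 2 ∂ν) / m ^ 2 := by
      refine (variance_le_expectation_sq hgm.aestronglyMeasurable).trans_eq ?_
      simp only [Pi.pow_apply, div_pow, integral_div]
    calc ∑ _k : Fin m, Var[fun θ => g θ / m; ν] ≤ m * ((∫ θ, g θ ^ 2 ∂ν) / m ^ 2) := by
          simpa using mul_le_mul_of_nonneg_left hle (Nat.cast_nonneg m)
      _ = _ := by field_simp
  rw [variance_eq_sub hXc, hmean] at hvar
  simp only [Pi.pow_apply] at hvar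
  linarith

/-- Integrals against a density, after dividing the integrand by the density. -/
lemma integral_div_withDensity {Ω : Type*} [MeasurableSpace Ω] {μ : Measure Ω} {p : Ω → ℝ}
    (hp : Measurable p) (hpos : ∀ᵐ θ ∂μ, 0 < p θ) (g : Ω → ℝ) :
    ∫ θ, g θ / p θ ∂(μ.withDensity fun θ => ENNReal.ofReal (p θ)) = ∫ θ, g θ ∂μ := by
  rw [integral_withDensity_eq_integral_toReal_smul hp.ennreal_ofReal (by simp)]
  refine integral_congr_ae ?_
  filter_upwards [hpos] with θ hθ
  rw [ENNReal.toReal_ofReal hθ.le, smul_eq_mul, mul_div_cancel₀ _ hθ.ne']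

lemma integrable_div_withDensity {Ω : Type*} [MeasurableSpace Ω] {μ : Measure Ω} {p : Ω → ℝ}
    (hp : Measurable p) (hpos : ∀ᵐ θ ∂μ, 0 < p θ) {g : Ω → ℝ} (hg : Integrable g μ) :
    Integrable (fun θ => g θ / p θ) (μ.withDensity fun θ => ENNReal.ofReal (p θ)) := by
  rw [integrable_withDensity_iff_integrable_smul' hp.ennreal_ofReal (by simp)]
  refine hg.congr ?_
  filter_upwards [hpos] with θ hθ
  rw [ENNReal.toReal_ofReal hθ.le, smul_eq_mul, mul_div_cancel₀ _ hθ.ne']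

/-- The importance-weighted random feature predictor: expected cumulative square loss plus
expected squared norm of the weights. -/
lemma integral_random_feature_loss_le {Ω : Type*} [MeasurableSpace Ω] (ν : Measure Ω)
    [IsProbabilityMeasure ν] {T m : ℕ} (hm : 0 < m) {h : Ω → ℝ} (hh : MemLp h 2 ν)
    (ψ : ℕ → Ω → ℝ) (hψ : ∀ t, Measurable (ψ t)) (hψb : ∀ t θ, ψ t θ ^ 2 ≤ 2) (y : ℕ → ℝ) :
    Integrable (fun η : Fin m → Ω =>
      ∑ t ∈ Finset.Icc 1 T, (∑ k, h (η k) / m * ψ t (η k) - y t) ^ 2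
        + ∑ k, h (η k) / m * (h (η k) / m)) (Measure.pi fun _ => ν) ∧
    ∫ η : Fin m → Ω, (∑ t ∈ Finset.Icc 1 T, (∑ k, h (η k) / m * ψ t (η k) - y t) ^ 2
        + ∑ k, h (η k) / m * (h (η k) / m)) ∂(Measure.pi fun _ => ν) ≤
      ∑ t ∈ Finset.Icc 1 T, (∫ θ, h θ * ψ t θ ∂ν - y t) ^ 2
        + (2 * T + 1) * (∫ θ, h θ ^ 2 ∂ν) / m := by
  have hm' : (m : ℝ) ≠ 0 := by exact_mod_cast hm.ne'
  have hb : ∀ t θ, |ψ t θ| ≤ √2 := fun t θ => Real.abs_le_sqrt (hψb t θ)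
  have hg : ∀ t, MemLp (fun θ => h θ * ψ t θ) 2 ν := fun t => by
    refine (hh.const_mul √2).mono (hh.1.mul (hψ t).aestronglyMeasurable) (.of_forall fun θ => ?_)
    simp only [norm_mul, Real.norm_eq_abs, abs_of_nonneg (Real.sqrt_nonneg 2)]
    rw [mul_comm]
    gcongr
    exact hb t θ
  have hgsq : ∀ t, ∫ θ, (h θ * ψ t θ) ^ 2 ∂ν ≤ 2 * ∫ θ, h θ ^ 2 ∂ν := fun t => by
    rw [← integral_const_mul]
    refine integral_mono (hg t).integrable_sq (hh.integrable_sq.const_mul 2) fun θ => ?_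
    simp only [mul_pow]
    nlinarith [hψb t θ, sq_nonneg (h θ)]
  have hloss := fun t => integral_sq_sum_div_sub_le ν hm (hg t) (y t)
  simp only [mul_div_right_comm _ _ (m : ℝ)] at hloss
  have hsq : Integrable (fun θ => h θ / m * (h θ / m)) ν := by
    refine (hh.integrable_sq.div_const ((m : ℝ) ^ 2)).congr (.of_forall fun θ => ?_)
    simp only
    ring
  have hsqk : ∀ k : Fin m, Integrable (fun η : Fin m → Ω => h (η k) / m * (h (η k) / m))
      (Measure.pi fun _ => ν) := fun k =>
    integrable_comp_eval (μ := fun _ : Fin m => ν) (f := fun θ => h θ / m * (h θ / m)) hsq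
  have hint1 := integrable_finsetSum (Finset.Icc 1 T) fun t _ => (hloss t).1
  have hint2 := integrable_finsetSum Finset.univ fun k _ => hsqk k
  refine ⟨hint1.add hint2, ?_⟩
  rw [integral_add hint1 hint2, integral_finsetSum _ fun t _ => (hloss t).1,
    integral_finsetSum _ fun k _ => hsqk k]
  have hnorm (k : Fin m) :
      ∫ η : Fin m → Ω, h (η k) / m * (h (η k) / m) ∂(Measure.pi fun _ => ν) =
        (∫ θ, h θ ^ 2 ∂ν) / m ^ 2 := by
    rw [integral_comp_eval (μ := fun _ : Fin m => ν) (f := fun θ => h θ / m * (h θ / m)) hsq.1,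
      ← integral_div]
    exact integral_congr_ae (.of_forall fun θ => by simp only; ring)
  have hlosssum := Finset.sum_le_sum fun t (_ : t ∈ Finset.Icc 1 T) => (hloss t).2.trans
    (add_le_add_right (div_le_div_of_nonneg_right (hgsq t) (Nat.cast_nonneg m)) _)
  rw [Finset.sum_add_distrib] at hlosssum
  simp only [hnorm, Finset.sum_const, Finset.card_univ, Fintype.card_fin, nsmul_eq_mul,
    Nat.card_Icc, add_tsub_cancel_right] at hlosssum ⊢
  refine (add_le_add_left hlosssum _).trans_eq ?_
  field_simp
  ring

end RandomFeatures

/-- **Theorem 2, asymptotic form (relation (3.16)).**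
There is a constant `C > 0` depending only on `N` and `Y` such that for every
`T ≥ 1`, taking `λ = 1` and `m = ⌈√T⌉`, for every multi-kernel random feature
setup (experts = VAW on each `(Φ_{θⱼ}(x_t), y_t)`, meta-algorithm = VAW on the
expert predictions `z_t`), every `R > 0`, every `j`, and every coefficient
function `γⱼ` with `Iⱼ ≤ R²`:
`(1/2) E_θ[∑ₜ (⟨α_t, z_t⟩ − y_t)²]
  ≤ (1/2) ∑ₜ (fⱼ(x_t) − y_t)² + C(1 + R²)(1 + ln(T+1))√T`. -/
theorem vaw_squared_asymptotic_bound (N : ℕ) (Y : ℝ) (hY : 0 < Y) :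
    ∃ C : ℝ, 0 < C ∧
    ∀ (d T m : ℕ), 1 ≤ T → m = ⌈Real.sqrt T⌉₊ →
    ∀ (Θ : Fin N → Type*) [∀ j, MeasurableSpace (Θ j)]
      (μ : ∀ j, Measure (Θ j)) [∀ j, SigmaFinite (μ j)]
      (p : ∀ j, Θ j → ℝ), (∀ j, Measurable (p j)) →
      (∀ j θ, 0 ≤ p j θ) →
      (∀ j, ∫⁻ θ, ENNReal.ofReal (p j θ) ∂(μ j) = 1) →
      (∀ j, ∀ᵐ θ ∂(μ j), 0 < p j θ) →
    ∀ (φ : ∀ j, (Fin d → ℝ) → Θ j → ℝ),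
      (∀ j, Measurable (fun q : (Fin d → ℝ) × Θ j => φ j q.1 q.2)) →
      (∀ j x θ, |φ j x θ| ≤ Real.sqrt 2) →
    ∀ (x : ℕ → Fin d → ℝ) (y : ℕ → ℝ), (∀ t ∈ Finset.Icc 1 T, |y t| ≤ Y) →
    -- the expert predictions `z ω t j = ⟨w_{t,j}, Φ_{θⱼ}(x_t)⟩`
    ∀ (z : (∀ j, Fin m → Θ j) → ℕ → Fin N → ℝ),
      (∀ ω t j, z ω t j =
        ∑ k, vaw 1 (fun s k' => φ j (x s) (ω j k')) y t k * φ j (x t) (ω j k)) →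
    -- the meta-level VAW iterates `α_t` applied to `(z_t, y_t)`
    ∀ (α : (∀ j, Fin m → Θ j) → ℕ → Fin N → ℝ),
      (∀ ω t, α ω t = vaw 1 (z ω) y t) →
    ∀ (R : ℝ), 0 < R →
    ∀ (j : Fin N) (γj : Θ j → ℝ), Measurable γj →
      Integrable (fun θ => γj θ ^ 2 / p j θ) (μ j) →
      (∫ θ, γj θ ^ 2 / p j θ ∂(μ j)) ≤ R ^ 2 →
    (1 / 2) * (∫ ω : ∀ j, Fin m → Θ j,
        (∑ t ∈ Finset.Icc 1 T, ((∑ i, α ω t i * z ω t i) - y t) ^ 2)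
        ∂(Measure.pi fun j' =>
            Measure.pi fun _ : Fin m => (μ j').withDensity fun θ => ENNReal.ofReal (p j' θ)))
      ≤ (1 / 2) * ∑ t ∈ Finset.Icc 1 T, ((∫ θ, γj θ * φ j (x t) θ ∂(μ j)) - y t) ^ 2
        + C * (1 + R ^ 2) * (1 + Real.log (T + 1)) * Real.sqrt T := by
  refine ⟨2 + 2 * Y ^ 2 + Y ^ 2 * (N * (N * (1 + 12 * Y ^ 2) + 2)) / 2, by positivity, ?_⟩
  intro d T m hT hm Θ _ μ _ p hp _ hp1 hpos φ hφ hφb x y hy z hz α hα R _ j γj hγ hγint hγR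
  set D : ℝ := 1 + 4 * Y ^ 2 + Y ^ 2 * (N * (N * (1 + 12 * Y ^ 2) + 2)) with hD
  set ν : ∀ j', Measure (Θ j') :=
    fun j' => (μ j').withDensity fun θ => ENNReal.ofReal (p j' θ) with hν
  have hνprob : ∀ j', IsProbabilityMeasure (ν j') := fun j' =>
    ⟨by rw [hν, withDensity_apply _ MeasurableSet.univ, Measure.restrict_univ, hp1]⟩
  have hT' : (1 : ℝ) ≤ T := by exact_mod_cast hT
  have hsqrt1 : 1 ≤ √(T : ℝ) := Real.one_le_sqrt.mpr hT'
  have hL : 0 ≤ Real.log ((T : ℝ) + 1) := Real.log_nonneg (by linarith)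
  have hmlow : √(T : ℝ) ≤ m := hm ▸ Nat.le_ceil _
  have hmhigh : (m : ℝ) ≤ 2 * √T := by
    have := Nat.ceil_lt_add_one (Real.sqrt_nonneg T)
    rw [← hm] at this
    linarith
  have hmpos : (0 : ℝ) < m := by linarith
  have hφsq : ∀ j' x θ, φ j' x θ ^ 2 ≤ 2 := fun j' x θ =>
    Real.sq_le (by norm_num) |>.mpr (abs_le.mp (hφb j' x θ))
  have hφm : ∀ t, Measurable (φ j (x t)) := fun t =>
    (hφ j).comp (measurable_const.prodMk measurable_id)
  have hh2 : ∀ θ, (γj θ / p j θ) ^ 2 = γj θ ^ 2 / p j θ / p j θ := fun θ => by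
    rw [div_pow, div_div, sq (p j θ)]
  have hh : MemLp (fun θ => γj θ / p j θ) 2 (ν j) := by
    refine (memLp_two_iff_integrable_sq (hγ.div (hp j)).aestronglyMeasurable).mpr ?_
    change Integrable (fun θ => (γj θ / p j θ) ^ 2) (ν j)
    simp only [hh2]
    exact integrable_div_withDensity (hp j) (hpos j) hγint
  have hhR : ∫ θ, (γj θ / p j θ) ^ 2 ∂(ν j) ≤ R ^ 2 := by
    simp only [hh2]
    rwa [hν, integral_div_withDensity (hp j) (hpos j)]
  have hmean : ∀ t, ∫ θ, γj θ / p j θ * φ j (x t) θ ∂(ν j) =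
      ∫ θ, γj θ * φ j (x t) θ ∂(μ j) := fun t => by
    rw [← integral_div_withDensity (hp j) (hpos j)]
    exact integral_congr_ae (.of_forall fun θ => div_mul_eq_mul_div _ _ _)
  obtain ⟨hint, hloss⟩ := integral_random_feature_loss_le (ν j) (T := T)
    (by exact_mod_cast hmpos : 0 < m) hh (fun t => φ j (x t)) hφm (fun t θ => hφsq j (x t) θ) y
  simp only [hmean] at hloss
  set F : (Fin m → Θ j) → ℝ := fun η =>
    ∑ t ∈ Finset.Icc 1 T, (∑ k, γj (η k) / p j (η k) / m * φ j (x t) (η k) - y t) ^ 2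
      + ∑ k, γj (η k) / p j (η k) / m * (γj (η k) / p j (η k) / m) with hF
  have hintF : Integrable (fun ω : ∀ j, Fin m → Θ j => F (ω j))
      (Measure.pi fun j' => Measure.pi fun _ : Fin m => ν j') :=
    integrable_comp_eval (μ := fun j' => Measure.pi fun _ : Fin m => ν j') hint
  have hpoint : ∀ ω : ∀ j, Fin m → Θ j,
      ∑ t ∈ Finset.Icc 1 T, ((∑ i, α ω t i * z ω t i) - y t) ^ 2 ≤
        F (ω j) + D * (√T * (1 + Real.log (T + 1))) := fun ω => by
    simp only [hα]
    exact vaw_two_level_regret_le hT hmhigh (fun j' s k => φ j' (x s) (ω j' k))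
      (fun j' t k => hφsq j' (x t) (ω j' k)) y hy (z ω) (hz ω) j
      (fun k => γj (ω j k) / p j (ω j k) / m)
  have hexp := integral_mono_of_nonneg
    (μ := Measure.pi fun j' => Measure.pi fun _ : Fin m => ν j')
    (.of_forall fun ω => Finset.sum_nonneg fun t _ => sq_nonneg ((∑ i, α ω t i * z ω t i) - y t))
    (hintF.add (integrable_const (D * (√T * (1 + Real.log (T + 1)))))) (.of_forall hpoint)
  simp only [Pi.add_apply] at hexp
  rw [integral_add hintF (integrable_const _), integral_const, probReal_univ, one_smul,
    integral_comp_eval (μ := fun j' => Measure.pi fun _ : Fin m => ν j') hint.1] at hexp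
  have hvar : (2 * T + 1) * (∫ θ, (γj θ / p j θ) ^ 2 ∂(ν j)) / m ≤ 3 * R ^ 2 * √T := by
    rw [div_le_iff₀ hmpos]
    have hsq : √(T : ℝ) * √T = T := Real.mul_self_sqrt (by linarith)
    calc (2 * T + 1) * (∫ θ, (γj θ / p j θ) ^ 2 ∂(ν j)) ≤ (3 * (√T * √T)) * R ^ 2 := by
          gcongr
          linarith
      _ = 3 * R ^ 2 * √T * √T := by ring
      _ ≤ 3 * R ^ 2 * √T * m := by gcongr
  have hRL : 3 * R ^ 2 * √T ≤ 3 * R ^ 2 * (√T * (1 + Real.log (T + 1))) := by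
    gcongr
    nlinarith
  have hDnonneg : 0 ≤ D := by positivity
  have hDR : 0 ≤ D * R ^ 2 * (√T * (1 + Real.log (T + 1))) := by positivity
  have hQ : 0 ≤ √T * (1 + Real.log (T + 1)) := by positivity
  have hC : 2 + 2 * Y ^ 2 + Y ^ 2 * (N * (N * (1 + 12 * Y ^ 2) + 2)) / 2 = (D + 3) / 2 := by
    rw [hD]
    ring
  rw [hC]
  linarith
end

section
/- Theorem 3 (loss bound for the VAW-EWA algorithm with truncated expert predictions, relation (3.27)): under the setup below, for every j ∈ {1,…,N} and every coefficient function γ_j, (1/2) E_θ[Σ_{t=1}^T (⟨α_t, z̄_t⟩ − y_t)²] ≤ (1/2) Σ_{t=1}^T (f_j(x_t) − y_t)² + 4 Y² ln N + (λ/2 + T)·I_j/m + (m Y²/2)·ln(1 + 2T/λ). -/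
open MeasureTheory

theorem dotProduct_mulVec_symm {ι : Type*} [Fintype ι] {A : Matrix ι ι ℝ} (hA : A.IsHermitian)
    (v w : ι → ℝ) : v ⬝ᵥ A.mulVec w = w ⬝ᵥ A.mulVec v := by
  have h : A.transpose = A := by simpa using hA.eq
  rw [Matrix.dotProduct_mulVec, ← Matrix.mulVec_transpose, h, dotProduct_comm]

theorem posDef_add_vecMulVec {ι : Type*} [Fintype ι] {A : Matrix ι ι ℝ}
    (hA : A.PosDef) (u : ι → ℝ) : (A + Matrix.vecMulVec u u).PosDef :=
  hA.add_posSemidef (by simpa using Matrix.posSemidef_vecMulVec_self_star u)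

theorem mulVec_add_vecMulVec {ι : Type*} [Fintype ι] (A : Matrix ι ι ℝ) (u v : ι → ℝ) :
    (A + Matrix.vecMulVec u u).mulVec v = A.mulVec v + (u ⬝ᵥ v) • u := by
  rw [Matrix.add_mulVec, Matrix.vecMulVec_mulVec]
  simp

/-- A rank-one update increases the log-determinant by at least `uᵀ (A + u uᵀ)⁻¹ u`. -/
theorem dotProduct_inv_le_log_det {ι : Type*} [Fintype ι] [DecidableEq ι] {A : Matrix ι ι ℝ}
    (hA : A.PosDef) (u : ι → ℝ) :
    u ⬝ᵥ (A + Matrix.vecMulVec u u)⁻¹.mulVec u ≤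
      Real.log (A + Matrix.vecMulVec u u).det - Real.log A.det := by
  have hS := posDef_add_vecMulVec hA u
  set S := A + Matrix.vecMulVec u u with hSdef
  have hdet : A.det = S.det * (1 - u ⬝ᵥ S⁻¹.mulVec u) := by
    have hAS : A = S + Matrix.replicateCol Unit (-u) * Matrix.replicateRow Unit u := by
      rw [← Matrix.vecMulVec_eq, Matrix.neg_vecMulVec, hSdef]
      abel
    refine (congrArg Matrix.det hAS).trans ?_
    rw [Matrix.det_add_replicateCol_mul_replicateRow
      ((Matrix.isUnit_iff_isUnit_det _).1 hS.isUnit)]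
    congr 1
    rw [Matrix.det_unique, Matrix.add_apply,
      Matrix.one_apply_eq, ← Matrix.replicateRow_vecMul, Matrix.replicateRow_mul_replicateCol_apply,
      ← Matrix.dotProduct_mulVec, Matrix.mulVec_neg, dotProduct_neg, ← sub_eq_add_neg]
  have hSp := hS.det_pos
  have hAp := hA.det_pos
  have hq : 0 < 1 - u ⬝ᵥ S⁻¹.mulVec u := by
    rw [hdet] at hAp
    exact (pos_iff_pos_of_mul_pos hAp).1 hSp
  have := Real.log_le_sub_one_of_pos hq
  rw [hdet, Real.log_mul hSp.ne' hq.ne']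
  linarith

/-- One-round loss of the VAW prediction, compared with the increase of the regularized
least-squares value. -/
theorem sq_vaw_prediction_sub_le {ι : Type*} [Fintype ι] [DecidableEq ι] {A : Matrix ι ι ℝ}
    (hA : A.PosDef) (u b : ι → ℝ) (y : ℝ) :
    ((A + Matrix.vecMulVec u u)⁻¹.mulVec b ⬝ᵥ u - y) ^ 2 ≤
      y ^ 2 + y ^ 2 * (u ⬝ᵥ (A + Matrix.vecMulVec u u)⁻¹.mulVec u) + b ⬝ᵥ A⁻¹.mulVec b
        - (b + y • u) ⬝ᵥ (A + Matrix.vecMulVec u u)⁻¹.mulVec (b + y • u) := by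
  have hS := posDef_add_vecMulVec hA u
  have hmul (v : ι → ℝ) := mulVec_add_vecMulVec A u v
  set S := A + Matrix.vecMulVec u u with hSdef
  have hSu := (Matrix.isUnit_iff_isUnit_det _).1 hS.isUnit
  have hAu := (Matrix.isUnit_iff_isUnit_det _).1 hA.isUnit
  set v := S⁻¹.mulVec b with hv
  have hb : b = A.mulVec v + (u ⬝ᵥ v) • u := by
    rw [← hmul, hv, Matrix.mulVec_mulVec, Matrix.mul_nonsing_inv _ hSu, Matrix.one_mulVec]
  have hsym : b ⬝ᵥ S⁻¹.mulVec u = u ⬝ᵥ v :=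
    dotProduct_mulVec_symm hS.inv.isHermitian b u
  have hAinv : A⁻¹.mulVec b = v + (u ⬝ᵥ v) • A⁻¹.mulVec u := by
    nth_rw 1 [hb]
    rw [Matrix.mulVec_add, Matrix.mulVec_mulVec, Matrix.nonsing_inv_mul _ hAu, Matrix.one_mulVec,
      Matrix.mulVec_smul]
  have hAbu : b ⬝ᵥ A⁻¹.mulVec u = u ⬝ᵥ v + (u ⬝ᵥ v) * (u ⬝ᵥ A⁻¹.mulVec u) := by
    rw [dotProduct_mulVec_symm hA.inv.isHermitian, hAinv]
    simp
  have hr : 0 ≤ u ⬝ᵥ A⁻¹.mulVec u := by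
    simpa using hA.inv.posSemidef.dotProduct_mulVec_nonneg u
  have hE : b ⬝ᵥ A⁻¹.mulVec b = b ⬝ᵥ v + (u ⬝ᵥ v) * (b ⬝ᵥ A⁻¹.mulVec u) := by
    rw [hAinv]; simp
  rw [Matrix.mulVec_add, Matrix.mulVec_smul, ← hv, dotProduct_comm v u]
  simp only [dotProduct_add, add_dotProduct, smul_dotProduct, dotProduct_smul, smul_eq_mul]
  rw [hE, hAbu, hsym]
  nlinarith [mul_nonneg (sq_nonneg (u ⬝ᵥ v)) hr]

/-- AM-GM for the eigenvalues, in logarithmic form. -/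
theorem log_det_le {ι : Type*} [Fintype ι] [DecidableEq ι] {S : Matrix ι ι ℝ} (hS : S.PosDef)
    {c : ℝ} (hc : 0 < c) (htr : S.trace ≤ Fintype.card ι * c) :
    Real.log S.det ≤ Fintype.card ι * Real.log c := by
  have hdet := hS.isHermitian.det_eq_prod_eigenvalues
  have htrace := hS.isHermitian.trace_eq_sum_eigenvalues
  simp only [RCLike.ofReal_real_eq_id, id] at hdet htrace
  rw [hdet, Real.log_prod fun i _ => (hS.eigenvalues_pos i).ne']
  have hi (i : ι) : Real.log (hS.isHermitian.eigenvalues i) ≤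
      hS.isHermitian.eigenvalues i / c - 1 + Real.log c := by
    have := Real.log_le_sub_one_of_pos (div_pos (hS.eigenvalues_pos i) hc)
    rw [Real.log_div (hS.eigenvalues_pos i).ne' hc.ne'] at this
    linarith
  calc _ ≤ ∑ i, (hS.isHermitian.eigenvalues i / c - 1 + Real.log c) :=
        Finset.sum_le_sum fun i _ => hi i
    _ = S.trace / c - Fintype.card ι + Fintype.card ι * Real.log c := by
      simp [Finset.sum_add_distrib, ← Finset.sum_div, htrace]
    _ ≤ _ := by
      have := (div_le_iff₀ hc).2 htr
      linarith

theorem posDef_smul_one_add_sum {ι : Type*} [Fintype ι] [DecidableEq ι] {lam : ℝ} (hlam : 0 < lam)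
    (u : ℕ → ι → ℝ) (s : Finset ℕ) :
    (lam • (1 : Matrix ι ι ℝ) + ∑ i ∈ s, Matrix.vecMulVec (u i) (u i)).PosDef :=
  (Matrix.PosDef.one.smul hlam).add_posSemidef
    (Matrix.posSemidef_sum _ fun i _ => by
      simpa using Matrix.posSemidef_vecMulVec_self_star (u i))

/-- Completing the square: the value of the regularized least-squares problem. -/
theorem neg_dotProduct_inv_le {ι : Type*} [Fintype ι] [DecidableEq ι] {S : Matrix ι ι ℝ}
    (hS : S.PosDef) (b w : ι → ℝ) :
    -(b ⬝ᵥ S⁻¹.mulVec b) ≤ w ⬝ᵥ S.mulVec w - 2 * (b ⬝ᵥ w) := by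
  have hSu := (Matrix.isUnit_iff_isUnit_det _).1 hS.isUnit
  have h := hS.posSemidef.dotProduct_mulVec_nonneg (w - S⁻¹.mulVec b)
  have hb : S.mulVec (S⁻¹.mulVec b) = b := by
    rw [Matrix.mulVec_mulVec, Matrix.mul_nonsing_inv _ hSu, Matrix.one_mulVec]
  have hc : S⁻¹.mulVec b ⬝ᵥ S.mulVec w = w ⬝ᵥ b := by
    rw [dotProduct_mulVec_symm hS.isHermitian, hb]
  simp only [star_trivial, Matrix.mulVec_sub, dotProduct_sub, sub_dotProduct, hb, hc] at h
  rw [dotProduct_comm (S⁻¹.mulVec b) b, dotProduct_comm w b] at h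
  linarith

/-- Cumulative VAW loss in terms of the regularized least-squares value and a log-determinant. -/
theorem vaw_loss_le_log_det {ι : Type*} [Fintype ι] [DecidableEq ι] {lam Y : ℝ} (hlam : 0 < lam)
    (u : ℕ → ι → ℝ) (y : ℕ → ℝ) (T : ℕ) (hy : ∀ t ∈ Finset.Icc 1 T, |y t| ≤ Y) :
    ∑ t ∈ Finset.Icc 1 T, (vaw lam u y t ⬝ᵥ u t - y t) ^ 2 ≤
      ∑ t ∈ Finset.Icc 1 T, y t ^ 2
        - (∑ t ∈ Finset.Icc 1 T, y t • u t) ⬝ᵥ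
          ((lam • (1 : Matrix ι ι ℝ) +
            ∑ t ∈ Finset.Icc 1 T, Matrix.vecMulVec (u t) (u t))⁻¹).mulVec
            (∑ t ∈ Finset.Icc 1 T, y t • u t)
        + Y ^ 2 * (Real.log (lam • (1 : Matrix ι ι ℝ) +
            ∑ t ∈ Finset.Icc 1 T, Matrix.vecMulVec (u t) (u t)).det
          - Fintype.card ι * Real.log lam) := by
  induction T with
  | zero => simp
  | succ T ih =>
    specialize ih fun t ht => hy t (Finset.Icc_subset_Icc_right T.le_succ ht)
    have hA := posDef_smul_one_add_sum hlam u (Finset.Icc 1 T)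
    have hstep := sq_vaw_prediction_sub_le hA (u (T + 1))
      (∑ t ∈ Finset.Icc 1 T, y t • u t) (y (T + 1))
    have hdet := dotProduct_inv_le_log_det hA (u (T + 1))
    have hnonneg := (posDef_add_vecMulVec hA (u (T + 1))).inv.posSemidef.dotProduct_mulVec_nonneg
      (u (T + 1))
    have hyT : y (T + 1) ^ 2 ≤ Y ^ 2 := sq_le_sq' (by linarith [abs_le.1 (hy (T + 1) (by simp))])
      (abs_le.1 (hy (T + 1) (by simp))).2
    have hvaw : vaw lam u y (T + 1) = ((lam • (1 : Matrix ι ι ℝ) +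
        ∑ t ∈ Finset.Icc 1 T, Matrix.vecMulVec (u t) (u t) +
          Matrix.vecMulVec (u (T + 1)) (u (T + 1)))⁻¹).mulVec
        (∑ t ∈ Finset.Icc 1 T, y t • u t) := by
      rw [vaw, Finset.sum_Icc_succ_top (by lia), ← add_assoc, Nat.add_sub_cancel]
    simp only [star_trivial] at hnonneg
    simp only [Finset.sum_Icc_succ_top (Nat.le_add_left 1 T), ← add_assoc, hvaw]
    have h1 := mul_le_mul_of_nonneg_right hyT hnonneg
    have h2 := mul_le_mul_of_nonneg_left hdet (sq_nonneg Y)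
    linarith

/-- Regret bound for the VAW forecaster with inputs of squared norm at most `B * card ι`. -/
theorem vaw_regret {ι : Type*} [Fintype ι] [DecidableEq ι] {lam Y B : ℝ} (hlam : 0 < lam)
    (hB : 0 ≤ B) (u : ℕ → ι → ℝ) (y : ℕ → ℝ) (T : ℕ) (hy : ∀ t ∈ Finset.Icc 1 T, |y t| ≤ Y)
    (hu : ∀ t, u t ⬝ᵥ u t ≤ Fintype.card ι * B) (w : ι → ℝ) :
    ∑ t ∈ Finset.Icc 1 T, (vaw lam u y t ⬝ᵥ u t - y t) ^ 2 ≤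
      ∑ t ∈ Finset.Icc 1 T, (w ⬝ᵥ u t - y t) ^ 2 + lam * (w ⬝ᵥ w)
        + Fintype.card ι * Y ^ 2 * Real.log (1 + B * T / lam) := by
  have hS := posDef_smul_one_add_sum hlam u (Finset.Icc 1 T)
  have h := vaw_loss_le_log_det hlam u y T hy
  have hmin := neg_dotProduct_inv_le hS (∑ t ∈ Finset.Icc 1 T, y t • u t) w
  have hc : 0 < lam + B * T := by positivity
  have hlog := log_det_le hS hc (by
    rw [Matrix.trace_add, Matrix.trace_smul, Matrix.trace_one, Matrix.trace_sum]
    simp only [Matrix.trace_vecMulVec]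
    have := Finset.sum_le_sum fun t (_ : t ∈ Finset.Icc 1 T) => hu t
    simp only [Finset.sum_const, Nat.card_Icc, Nat.add_sub_cancel, nsmul_eq_mul] at this
    rw [smul_eq_mul]
    linarith)
  have hlog' : Real.log (1 + B * T / lam) = Real.log (lam + B * T) - Real.log lam := by
    rw [← Real.log_div hc.ne' hlam.ne', add_div, div_self hlam.ne']
  have hquad : w ⬝ᵥ (lam • (1 : Matrix ι ι ℝ) +
      ∑ t ∈ Finset.Icc 1 T, Matrix.vecMulVec (u t) (u t)).mulVec w =
      lam * (w ⬝ᵥ w) + ∑ t ∈ Finset.Icc 1 T, (w ⬝ᵥ u t) ^ 2 := by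
    rw [Matrix.add_mulVec, Matrix.smul_mulVec, Matrix.one_mulVec, Matrix.sum_mulVec,
      dotProduct_add, dotProduct_sum, dotProduct_smul, smul_eq_mul]
    congr 1
    refine Finset.sum_congr rfl fun t _ => ?_
    rw [Matrix.vecMulVec_mulVec, op_smul_eq_smul, dotProduct_smul, dotProduct_comm (u t) w,
      smul_eq_mul, sq]
  have hlin : (∑ t ∈ Finset.Icc 1 T, y t • u t) ⬝ᵥ w = ∑ t ∈ Finset.Icc 1 T, y t * (w ⬝ᵥ u t) := by
    rw [sum_dotProduct]
    refine Finset.sum_congr rfl fun t _ => ?_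
    rw [smul_dotProduct, smul_eq_mul, dotProduct_comm]
  have hsq : ∑ t ∈ Finset.Icc 1 T, (w ⬝ᵥ u t - y t) ^ 2 =
      ∑ t ∈ Finset.Icc 1 T, (w ⬝ᵥ u t) ^ 2 - 2 * ∑ t ∈ Finset.Icc 1 T, y t * (w ⬝ᵥ u t)
        + ∑ t ∈ Finset.Icc 1 T, y t ^ 2 := by
    rw [Finset.mul_sum, ← Finset.sum_sub_distrib, ← Finset.sum_add_distrib]
    exact Finset.sum_congr rfl fun t _ => by ring
  rw [hquad, hlin] at hmin
  rw [hlog', hsq]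
  have := mul_le_mul_of_nonneg_left hlog (sq_nonneg Y)
  linarith

theorem concaveOn_exp_neg_mul_sq {η B : ℝ} (hη : 0 ≤ η) (h : 2 * η * B ^ 2 ≤ 1) :
    ConcaveOn ℝ (Set.Icc (-B) B) fun u => Real.exp (-η * u ^ 2) := by
  have h1 (u : ℝ) : HasDerivAt (fun u => Real.exp (-η * u ^ 2))
      (Real.exp (-η * u ^ 2) * (-2 * η * u)) u := by
    convert! ((hasDerivAt_pow 2 u).const_mul (-η)).exp using 1
    norm_num; ring
  have hd : deriv (fun u => Real.exp (-η * u ^ 2)) =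
      fun u => Real.exp (-η * u ^ 2) * (-2 * η * u) := funext fun u => (h1 u).deriv
  have h2 (u : ℝ) : HasDerivAt (fun u => Real.exp (-η * u ^ 2) * (-2 * η * u))
      (2 * η * Real.exp (-η * u ^ 2) * (2 * η * u ^ 2 - 1)) u := by
    convert! (h1 u).mul ((hasDerivAt_id u).const_mul (-2 * η)) using 1
    simp; ring
  refine concaveOn_of_deriv2_nonpos' (convex_Icc _ _)
    (fun u _ => (h1 u).differentiableAt.differentiableWithinAt) ?_ ?_
  · rw [hd]
    exact fun u _ => (h2 u).differentiableAt.differentiableWithinAt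
  · intro u hu
    simp only [Function.iterate_succ, Function.iterate_zero, Function.comp, id, hd, (h2 u).deriv]
    have : u ^ 2 ≤ B ^ 2 := sq_le_sq' hu.1 hu.2
    refine mul_nonpos_of_nonneg_of_nonpos (by positivity) ?_
    nlinarith

/-- Regret bound for the exponentially weighted average forecaster with the square loss. -/
theorem ewa_regret {κ : Type*} [Fintype κ] {η B : ℝ} (hη : 0 < η) (hηB : 2 * η * B ^ 2 ≤ 1)
    (z : ℕ → κ → ℝ) (y : ℕ → ℝ) (T : ℕ)
    (hz : ∀ t ∈ Finset.Icc 1 T, ∀ i, |z t i - y t| ≤ B) (α : ℕ → κ → ℝ)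
    (hα : ∀ t i, α t i = Real.exp (-η * ∑ s ∈ Finset.Icc 1 (t - 1), (z s i - y s) ^ 2) /
      ∑ k, Real.exp (-η * ∑ s ∈ Finset.Icc 1 (t - 1), (z s k - y s) ^ 2)) (j : κ) :
    ∑ t ∈ Finset.Icc 1 T, (∑ i, α t i * z t i - y t) ^ 2 ≤
      ∑ t ∈ Finset.Icc 1 T, (z t j - y t) ^ 2 + Real.log (Fintype.card κ) / η := by
  have : Nonempty κ := ⟨j⟩
  set W : ℕ → ℝ := fun t => ∑ k, Real.exp (-η * ∑ s ∈ Finset.Icc 1 t, (z s k - y s) ^ 2) with hW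
  have hWpos (t : ℕ) : 0 < W t := Finset.sum_pos (fun k _ => Real.exp_pos _) Finset.univ_nonempty
  have hpot (n : ℕ) (hn : n ≤ T) : η * ∑ t ∈ Finset.Icc 1 n, (∑ i, α t i * z t i - y t) ^ 2 ≤
      Real.log (W 0) - Real.log (W n) := by
    induction n with
    | zero => simp
    | succ n ih =>
      have hαn (i : κ) : α (n + 1) i =
          Real.exp (-η * ∑ s ∈ Finset.Icc 1 n, (z s i - y s) ^ 2) / W n := hα (n + 1) i
      have hsum : ∑ i, α (n + 1) i = 1 := by
        simp only [hαn, ← Finset.sum_div]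
        exact div_self (hWpos n).ne'
      have hconc := (concaveOn_exp_neg_mul_sq hη.le hηB).le_map_sum (t := Finset.univ)
        (w := α (n + 1)) (p := fun i => z (n + 1) i - y (n + 1))
        (fun i _ => by rw [hαn]; exact div_nonneg (Real.exp_pos _).le (hWpos n).le) hsum
        (fun i _ => abs_le.1 (hz (n + 1) (Finset.mem_Icc.2 ⟨by lia, hn⟩) i))
      have hmean : ∑ i, α (n + 1) i • (z (n + 1) i - y (n + 1)) =
          ∑ i, α (n + 1) i * z (n + 1) i - y (n + 1) := by
        simp only [smul_eq_mul, mul_sub, Finset.sum_sub_distrib, ← Finset.sum_mul, hsum, one_mul]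
      have hratio : ∑ i, α (n + 1) i • Real.exp (-η * (z (n + 1) i - y (n + 1)) ^ 2) =
          W (n + 1) / W n := by
        rw [hW, Finset.sum_div]
        refine Finset.sum_congr rfl fun i _ => ?_
        rw [hαn, Finset.sum_Icc_succ_top (by lia), mul_add, Real.exp_add, smul_eq_mul]
        ring
      rw [hmean, hratio] at hconc
      have hlog := Real.log_le_log (div_pos (hWpos _) (hWpos _)) hconc
      rw [Real.log_div (hWpos _).ne' (hWpos _).ne', Real.log_exp] at hlog
      rw [Finset.sum_Icc_succ_top (by lia), mul_add]
      linarith [ih (by lia)]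
  have hW0 : W 0 = Fintype.card κ := by simp [hW]
  have hWT : -η * ∑ s ∈ Finset.Icc 1 T, (z s j - y s) ^ 2 ≤ Real.log (W T) := by
    rw [Real.le_log_iff_exp_le (hWpos T)]
    exact Finset.single_le_sum (f := fun k =>
      Real.exp (-η * ∑ s ∈ Finset.Icc 1 T, (z s k - y s) ^ 2))
      (fun k _ => (Real.exp_pos _).le) (Finset.mem_univ j)
  have h := hpot T le_rfl
  rw [hW0] at h
  rw [← sub_le_iff_le_add', le_div_iff₀ hη]
  linarith

/-- Bias-variance bound for the empirical mean of `m` independent samples. -/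
theorem integral_sq_empiricalMean_sub_le {Ω : Type*} [MeasurableSpace Ω] {ν : Measure Ω}
    [IsProbabilityMeasure ν] {ψ : Ω → ℝ} (hψ : MemLp ψ 2 ν) {m : ℕ} (hm : 0 < m) (c : ℝ) :
    Integrable (fun ω : Fin m → Ω => (∑ k, ψ (ω k) / m - c) ^ 2) (Measure.pi fun _ => ν) ∧
    ∫ ω : Fin m → Ω, (∑ k, ψ (ω k) / m - c) ^ 2 ∂(Measure.pi fun _ => ν) ≤
      (∫ θ, ψ θ ∂ν - c) ^ 2 + (∫ θ, ψ θ ^ 2 ∂ν) / m := by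
  have hm' : (m : ℝ) ≠ 0 := by positivity
  have hψm : MemLp (fun θ => ψ θ / m) 2 ν := by simpa [div_eq_mul_inv] using hψ.mul_const (m : ℝ)⁻¹
  have hk (k : Fin m) : MemLp (fun ω : Fin m → Ω => ψ (ω k) / m) 2 (Measure.pi fun _ => ν) :=
    hψm.comp_measurePreserving (measurePreserving_eval _ k)
  have hZ : MemLp (fun ω : Fin m → Ω => ∑ k, ψ (ω k) / m) 2 (Measure.pi fun _ => ν) :=
    memLp_finsetSum _ fun k _ => hk k
  have hX : MemLp (fun ω : Fin m → Ω => ∑ k, ψ (ω k) / m - c) 2 (Measure.pi fun _ => ν) :=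
    hZ.sub (memLp_const c)
  refine ⟨hX.integrable_sq, ?_⟩
  have hmean : ∫ ω : Fin m → Ω, (∑ k, ψ (ω k) / m - c) ∂(Measure.pi fun _ => ν) =
      ∫ θ, ψ θ ∂ν - c := by
    rw [integral_sub (hZ.integrable one_le_two) (integrable_const _),
      integral_finsetSum _ fun k _ => (hk k).integrable one_le_two]
    have hk' (k : Fin m) : ∫ ω : Fin m → Ω, ψ (ω k) / m ∂(Measure.pi fun _ => ν) =
        (∫ θ, ψ θ ∂ν) / m := by
      rw [integral_comp_eval (μ := fun _ : Fin m => ν) (f := fun θ => ψ θ / m)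
        hψm.aestronglyMeasurable, integral_div]
    simp only [hk', integral_const, probReal_univ, one_smul, Finset.sum_const, Finset.card_univ,
      Fintype.card_fin, nsmul_eq_mul, mul_div_cancel₀ _ hm']
  have hvar : ProbabilityTheory.variance (fun ω : Fin m → Ω => ∑ k, ψ (ω k) / m - c)
      (Measure.pi fun _ => ν) ≤ (∫ θ, ψ θ ^ 2 ∂ν) / m := by
    rw [ProbabilityTheory.variance_sub_const hZ.aestronglyMeasurable]
    have h := ProbabilityTheory.variance_sum_pi (μ := fun _ : Fin m => ν)
      (X := fun _ θ => ψ θ / m) fun _ => hψm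
    rw [show (fun ω : Fin m → Ω => ∑ k, ψ (ω k) / m) = ∑ k, fun ω : Fin m → Ω => ψ (ω k) / m by
      ext; simp, h]
    simp only [div_eq_mul_inv, ProbabilityTheory.variance_mul_const, Finset.sum_const,
      Finset.card_univ, Fintype.card_fin, nsmul_eq_mul]
    have hv := ProbabilityTheory.variance_le_expectation_sq hψ.aestronglyMeasurable
    simp only [Pi.pow_apply] at hv
    calc _ = ProbabilityTheory.variance ψ ν * (m : ℝ)⁻¹ := by field_simp
      _ ≤ _ := mul_le_mul_of_nonneg_right hv (by positivity)
  rw [ProbabilityTheory.variance_eq_sub hX, hmean] at hvar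
  simp only [Pi.pow_apply] at hvar
  linarith

/-- Importance weighting: change of measure from `μ` to the sampling distribution `p • μ`. -/
theorem importance_weight {Ω : Type*} [MeasurableSpace Ω] {μ : Measure Ω} {p γ : Ω → ℝ}
    (hp : Measurable p) (hp0 : ∀ θ, 0 ≤ p θ) (hpos : ∀ᵐ θ ∂μ, 0 < p θ) (hγ : Measurable γ)
    (hI : Integrable (fun θ => γ θ ^ 2 / p θ) μ) :
    MemLp (fun θ => γ θ / p θ) 2 (μ.withDensity fun θ => ENNReal.ofReal (p θ)) ∧
    ∫ θ, (γ θ / p θ) ^ 2 ∂(μ.withDensity fun θ => ENNReal.ofReal (p θ)) =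
      ∫ θ, γ θ ^ 2 / p θ ∂μ ∧
    ∀ φ : Ω → ℝ, ∫ θ, γ θ / p θ * φ θ ∂(μ.withDensity fun θ => ENNReal.ofReal (p θ)) =
      ∫ θ, γ θ * φ θ ∂μ := by
  have hfin : ∀ᵐ θ ∂μ, ENNReal.ofReal (p θ) < ⊤ := by simp
  have hsq : (fun θ => (ENNReal.ofReal (p θ)).toReal • (γ θ / p θ) ^ 2) =ᵐ[μ]
      fun θ => γ θ ^ 2 / p θ := by
    filter_upwards [hpos] with θ hθ
    rw [ENNReal.toReal_ofReal (hp0 θ), smul_eq_mul]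
    field_simp
  refine ⟨?_, ?_, fun φ => ?_⟩
  · have hmeas : Measurable fun θ => γ θ / p θ := hγ.div hp
    rw [memLp_two_iff_integrable_sq hmeas.aestronglyMeasurable,
      integrable_withDensity_iff_integrable_smul' hp.ennreal_ofReal hfin]
    exact hI.congr hsq.symm
  · rw [integral_withDensity_eq_integral_toReal_smul hp.ennreal_ofReal hfin]
    exact integral_congr_ae hsq
  · rw [integral_withDensity_eq_integral_toReal_smul hp.ennreal_ofReal hfin]
    refine integral_congr_ae ?_
    filter_upwards [hpos] with θ hθ
    rw [ENNReal.toReal_ofReal (hp0 θ), smul_eq_mul]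
    field_simp

/-- Expected regularized square loss of the random-feature approximation with importance weights
`g (ω k) / m`. -/
theorem integral_randomFeature_loss_le {Ω : Type*} [MeasurableSpace Ω] {ν : Measure Ω}
    [IsProbabilityMeasure ν] {g : Ω → ℝ} (hg : MemLp g 2 ν) {lam C : ℝ}
    {φ : ℕ → Ω → ℝ} (hφ : ∀ t, Measurable (φ t)) (hφC : ∀ t θ, |φ t θ| ≤ C)
    {m : ℕ} (hm : 0 < m) (y : ℕ → ℝ) (s : Finset ℕ) :
    Integrable (fun ω : Fin m → Ω => ∑ t ∈ s, (∑ k, g (ω k) / m * φ t (ω k) - y t) ^ 2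
        + lam * ∑ k, g (ω k) / m * (g (ω k) / m)) (Measure.pi fun _ => ν) ∧
    ∫ ω : Fin m → Ω, (∑ t ∈ s, (∑ k, g (ω k) / m * φ t (ω k) - y t) ^ 2
        + lam * ∑ k, g (ω k) / m * (g (ω k) / m)) ∂(Measure.pi fun _ => ν) ≤
      ∑ t ∈ s, (∫ θ, g θ * φ t θ ∂ν - y t) ^ 2 +
        (lam + s.card * C ^ 2) * (∫ θ, g θ ^ 2 ∂ν) / m := by
  have hm' : (m : ℝ) ≠ 0 := by positivity
  have hψ (t : ℕ) : MemLp (fun θ => g θ * φ t θ) 2 ν :=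
    hg.of_le_mul (c := C) (hg.aestronglyMeasurable.mul (hφ t).aestronglyMeasurable)
      (.of_forall fun θ => by
        rw [norm_mul, mul_comm]
        exact mul_le_mul_of_nonneg_right (hφC t θ) (norm_nonneg _))
  have hmc (t : ℕ) := integral_sq_empiricalMean_sub_le (hψ t) hm (y t)
  have hψsq (t : ℕ) : ∫ θ, (g θ * φ t θ) ^ 2 ∂ν ≤ C ^ 2 * ∫ θ, g θ ^ 2 ∂ν := by
    rw [← integral_const_mul]
    refine integral_mono (hψ t).integrable_sq (hg.integrable_sq.const_mul _) fun θ => ?_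
    rw [mul_pow, mul_comm]
    have := abs_le.1 (hφC t θ)
    exact mul_le_mul_of_nonneg_right (sq_le_sq' this.1 this.2) (sq_nonneg _)
  have hrw (ω : Fin m → Ω) (t : ℕ) : ∑ k, g (ω k) / m * φ t (ω k) =
      ∑ k, g (ω k) * φ t (ω k) / m := Finset.sum_congr rfl fun k _ => by ring
  have hreg (k : Fin m) : Integrable (fun ω : Fin m → Ω => g (ω k) / m * (g (ω k) / m))
      (Measure.pi fun _ => ν) :=
    integrable_comp_eval (μ := fun _ : Fin m => ν) (f := fun θ => g θ / m * (g θ / m)) (by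
      convert! hg.integrable_sq.mul_const ((m : ℝ) ^ 2)⁻¹ using 2
      field_simp)
  have hregint (k : Fin m) : ∫ ω : Fin m → Ω, g (ω k) / m * (g (ω k) / m)
      ∂(Measure.pi fun _ => ν) = (∫ θ, g θ ^ 2 ∂ν) / m ^ 2 := by
    rw [integral_comp_eval (μ := fun _ : Fin m => ν) (f := fun θ => g θ / m * (g θ / m))
      (((hg.aestronglyMeasurable.aemeasurable.div_const _).mul
        (hg.aestronglyMeasurable.aemeasurable.div_const _)).aestronglyMeasurable),
      ← integral_div]
    exact integral_congr_ae (.of_forall fun θ => by field_simp)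
  simp only [hrw]
  have hInt1 := integrable_finsetSum s fun t _ => (hmc t).1
  have hInt2 := (integrable_finsetSum Finset.univ fun k _ => hreg k).const_mul lam
  refine ⟨hInt1.add hInt2, ?_⟩
  rw [integral_add hInt1 hInt2, integral_finsetSum _ fun t _ => (hmc t).1, integral_const_mul,
    integral_finsetSum _ fun k _ => hreg k]
  simp only [hregint, Finset.sum_const, Finset.card_univ, Fintype.card_fin, nsmul_eq_mul]
  have hsum : ∑ t ∈ s, ∫ ω : Fin m → Ω, (∑ k, g (ω k) * φ t (ω k) / m - y t) ^ 2
      ∂(Measure.pi fun _ => ν) ≤ ∑ t ∈ s, ((∫ θ, g θ * φ t θ ∂ν - y t) ^ 2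
        + C ^ 2 * (∫ θ, g θ ^ 2 ∂ν) / m) :=
    Finset.sum_le_sum fun t _ => (hmc t).2.trans
      (add_le_add le_rfl (div_le_div_of_nonneg_right (hψsq t) (by positivity)))
  rw [Finset.sum_add_distrib, Finset.sum_const, nsmul_eq_mul] at hsum
  refine (add_le_add hsum le_rfl).trans_eq ?_
  field_simp
  ring

theorem abs_clamp_sub_le {Y y : ℝ} (hy : |y| ≤ Y) (z : ℝ) :
    |min Y (max z (-Y)) - y| ≤ |z - y| ∧ |min Y (max z (-Y)) - y| ≤ 2 * Y := by
  obtain ⟨h1, h2⟩ := abs_le.1 hy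
  grind

/-- **Theorem 3: loss bound for the VAW-EWA algorithm with truncated expert
predictions (relation (3.27)).**
Multi-kernel random feature setup as before.  Experts: for each `j`, `w_{t,j}`
are the VAW iterates on `(Φ_{θⱼ}(x_t), y_t)` and `z_{t,j} = ⟨w_{t,j}, Φ_{θⱼ}(x_t)⟩`;
truncated predictions `z̄_{t,j} = min(Y, max(z_{t,j}, −Y))`.
Meta-algorithm: the exponentially weighted average forecaster with learning rate
`η = 1/(8Y²)`:
`α_{t,j} = exp(−η ∑_{s<t} (z̄_{s,j}−y_s)²) / ∑ₖ exp(−η ∑_{s<t} (z̄_{s,k}−y_s)²)`.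
For every `j` and every coefficient function `γⱼ` with `Iⱼ = ∫ γⱼ²/pⱼ dμⱼ < ∞`
and `fⱼ(x) = ∫ γⱼ(θ) φⱼ(x,θ) dμⱼ(θ)`:
`(1/2) E_θ[∑ₜ (⟨α_t, z̄_t⟩ − y_t)²] ≤ (1/2) ∑ₜ (fⱼ(x_t) − y_t)²
  + 4Y² ln N + (λ/2 + T) Iⱼ/m + (m Y²/2) ln(1 + 2T/λ)`. -/
theorem vaw_ewa_truncated_loss_bound
    (d N m T : ℕ) (hm : 0 < m) (lam Y : ℝ) (hlam : 0 < lam) (hY : 0 < Y)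
    (Θ : Fin N → Type*) [∀ j, MeasurableSpace (Θ j)]
    (μ : ∀ j, Measure (Θ j)) [∀ j, SigmaFinite (μ j)]
    (p : ∀ j, Θ j → ℝ) (hp_meas : ∀ j, Measurable (p j))
    (hp_nonneg : ∀ j θ, 0 ≤ p j θ)
    (hp_prob : ∀ j, ∫⁻ θ, ENNReal.ofReal (p j θ) ∂(μ j) = 1)
    (hp_pos : ∀ j, ∀ᵐ θ ∂(μ j), 0 < p j θ)
    (φ : ∀ j, (Fin d → ℝ) → Θ j → ℝ)
    (hφ_meas : ∀ j, Measurable (fun q : (Fin d → ℝ) × Θ j => φ j q.1 q.2))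
    (hφ_bdd : ∀ j x θ, |φ j x θ| ≤ Real.sqrt 2)
    (x : ℕ → Fin d → ℝ) (y : ℕ → ℝ)
    (hy : ∀ t ∈ Finset.Icc 1 T, |y t| ≤ Y)
    -- the expert predictions `z ω t j = ⟨w_{t,j}, Φ_{θⱼ}(x_t)⟩`
    (z : (∀ j, Fin m → Θ j) → ℕ → Fin N → ℝ)
    (hz : ∀ ω t j, z ω t j =
      ∑ k, vaw lam (fun s k' => φ j (x s) (ω j k')) y t k * φ j (x t) (ω j k))
    -- the truncated expert predictions `z̄_{t,j} = min(Y, max(z_{t,j}, −Y))`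
    (zbar : (∀ j, Fin m → Θ j) → ℕ → Fin N → ℝ)
    (hzbar : ∀ ω t i, zbar ω t i = min Y (max (z ω t i) (-Y)))
    -- the EWA weights with learning rate `η = 1/(8Y²)`
    (α : (∀ j, Fin m → Θ j) → ℕ → Fin N → ℝ)
    (hα : ∀ ω t i, α ω t i =
      Real.exp (-(1 / (8 * Y ^ 2)) * ∑ s ∈ Finset.Icc 1 (t - 1), (zbar ω s i - y s) ^ 2)
        / ∑ k, Real.exp (-(1 / (8 * Y ^ 2)) * ∑ s ∈ Finset.Icc 1 (t - 1), (zbar ω s k - y s) ^ 2))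
    (j : Fin N) (γj : Θ j → ℝ) (hγ_meas : Measurable γj)
    (hI : Integrable (fun θ => γj θ ^ 2 / p j θ) (μ j)) :
    (1 / 2) * ∫ ω : ∀ j, Fin m → Θ j,
        (∑ t ∈ Finset.Icc 1 T, ((∑ i, α ω t i * zbar ω t i) - y t) ^ 2)
        ∂(Measure.pi fun j' =>
            Measure.pi fun _ : Fin m => (μ j').withDensity fun θ => ENNReal.ofReal (p j' θ))
      ≤ (1 / 2) * ∑ t ∈ Finset.Icc 1 T, ((∫ θ, γj θ * φ j (x t) θ ∂(μ j)) - y t) ^ 2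
        + 4 * Y ^ 2 * Real.log N
        + (lam / 2 + T) * (∫ θ, γj θ ^ 2 / p j θ ∂(μ j)) / m
        + m * Y ^ 2 / 2 * Real.log (1 + 2 * T / lam) := by
  have hν (i : Fin N) : IsProbabilityMeasure
      ((μ i).withDensity fun θ => ENNReal.ofReal (p i θ)) :=
    ⟨by rw [withDensity_apply _ MeasurableSet.univ, Measure.restrict_univ, hp_prob]⟩
  obtain ⟨hg, hg_sq, hg_mul⟩ :=
    importance_weight (hp_meas j) (hp_nonneg j) (hp_pos j) hγ_meas hI
  obtain ⟨hInt, hle⟩ := integral_randomFeature_loss_le (lam := lam) hg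
    (φ := fun t => φ j (x t)) (fun t => (hφ_meas j).of_uncurry_left)
    (fun t => hφ_bdd j (x t)) hm y (Finset.Icc 1 T)
  simp only [hg_mul, hg_sq, Nat.card_Icc, Nat.add_sub_cancel, Real.sq_sqrt zero_le_two] at hle
  have hpt (ω : ∀ j, Fin m → Θ j) :
      ∑ t ∈ Finset.Icc 1 T, ((∑ i, α ω t i * zbar ω t i) - y t) ^ 2 ≤
        (∑ t ∈ Finset.Icc 1 T,
            (∑ k, γj (ω j k) / p j (ω j k) / m * φ j (x t) (ω j k) - y t) ^ 2
          + lam * ∑ k, γj (ω j k) / p j (ω j k) / m * (γj (ω j k) / p j (ω j k) / m))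
        + (m * Y ^ 2 * Real.log (1 + 2 * T / lam) + 8 * Y ^ 2 * Real.log N) := by
    have hclamp (t : ℕ) (ht : t ∈ Finset.Icc 1 T) (i : Fin N) :=
      abs_clamp_sub_le (hy t ht) (z ω t i)
    simp only [← hzbar] at hclamp
    have hewa := ewa_regret (η := 1 / (8 * Y ^ 2)) (B := 2 * Y) (by positivity)
      (by field_simp; norm_num) (zbar ω) y T (fun t ht i => (hclamp t ht i).2) (α ω) (hα ω) j
    have hvaw := vaw_regret hlam zero_le_two (fun s k => φ j (x s) (ω j k)) y T hy (fun t => by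
      refine (Finset.sum_le_card_nsmul _ _ 2 fun k _ => ?_).trans_eq (by simp)
      have h := abs_le.1 (hφ_bdd j (x t) (ω j k))
      rw [← sq]
      exact (sq_le_sq' h.1 h.2).trans_eq (Real.sq_sqrt zero_le_two))
      (fun k => γj (ω j k) / p j (ω j k) / m)
    have htrunc : ∑ t ∈ Finset.Icc 1 T, (zbar ω t j - y t) ^ 2 ≤
        ∑ t ∈ Finset.Icc 1 T,
          (vaw lam (fun s k => φ j (x s) (ω j k)) y t ⬝ᵥ (fun k => φ j (x t) (ω j k)) - y t) ^ 2 :=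
      Finset.sum_le_sum fun t ht => by
        have h := (hclamp t ht j).1
        rw [hz] at h
        exact sq_le_sq.2 h
    simp only [dotProduct, Fintype.card_fin] at hvaw htrunc hewa
    have hdiv : Real.log N / (1 / (8 * Y ^ 2)) = 8 * Y ^ 2 * Real.log N := by field_simp
    rw [hdiv] at hewa
    linarith
  have hInt' := integrable_comp_eval (μ := fun i : Fin N =>
    Measure.pi fun _ : Fin m => (μ i).withDensity fun θ => ENNReal.ofReal (p i θ)) (i := j) hInt
  have hmono := integral_mono_of_nonneg
    (.of_forall fun ω => Finset.sum_nonneg fun t _ => sq_nonneg _)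
    (hInt'.add (integrable_const (m * Y ^ 2 * Real.log (1 + 2 * T / lam) + 8 * Y ^ 2 * Real.log N)))
    (.of_forall hpt)
  simp only [Pi.add_apply] at hmono
  rw [integral_add hInt' (integrable_const _), integral_const, probReal_univ, one_smul,
    integral_comp_eval (μ := fun i : Fin N =>
      Measure.pi fun _ : Fin m => (μ i).withDensity fun θ => ENNReal.ofReal (p i θ)) (i := j)
      hInt.aestronglyMeasurable] at hmono
  have hsplit : (lam + T * 2) * (∫ θ, γj θ ^ 2 / p j θ ∂(μ j)) / m =
      2 * ((lam / 2 + T) * (∫ θ, γj θ ^ 2 / p j θ ∂(μ j)) / m) := by ring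
  linarith
end
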